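/- arXiv:2105.01319 — 2 statements merged into one kernel-verified Lean document; each statement's English description precedes it below -/
import Mathlib

section
/- Let F be a field of characteristic p > 0 with F^{p−1} = F, and let S_1, ..., S_{r+1} ⊆ F be nonempty sets with pdeg(S_i) = 1 for i = 1, ..., r and dS_1 ∧ ... ∧ dS_r ∧ dS_{r+1} ≠ {0}. Write pdeg(S_1 ∪ ... ∪ S_r ∪ S_{r+1}) = r + ℓ with ℓ ∈ ℤ. Then ℓ ≥ 1, and for any p-independent {a_1, ..., a_r, e_1, ..., e_ℓ} ⊆ F with F^p(S_i) = F^p(a_i) for i = 1, ..., r and F^p(a_1, ..., a_r)(S_{r+1}) = F^p(a_1, ..., a_r)(e_1, ..., e_ℓ), one has ann ν^n_F(dS_1 ∧ ... ∧ dS_r ∧ dS_{r+1}) = [dx/x | x ∈ F^p(a_1, ..., a_r)^*] ∧ ν_{n−1}(F) + [dy_1/y_1 ∧ ... ∧ dy_ℓ/y_ℓ | y_1, ..., y_ℓ ∈ F^p(a_1, ..., a_r, e_1, ..., e_ℓ)^*] ∧ ν_{n−ℓ}(F). -/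
set_option synthInstance.maxHeartbeats 1000000
set_option maxHeartbeats 1000000

open ExteriorAlgebra

noncomputable section Preamble

variable (F : Type) [Field F] (p : ℕ)

/-- The subfield `F^{p^t}(C)` of `F` generated by the `p^t`-th powers and the set `C`. -/
def pClosureT (t : ℕ) (C : Set F) : Subfield F :=
  Subfield.closure ((Set.range fun x : F => x ^ p ^ t) ∪ C)

/-- The subfield `F^p(C)` of `F` generated by the `p`-th powers and the set `C`. -/
def pClosure (C : Set F) : Subfield F := pClosureT F p 1 C

/-- The degree `[B(A) : B]` for a subfield `B` of `F` and a subset `A ⊆ F`. -/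
def relDeg (B : Subfield F) (A : Set F) : ℕ :=
  Module.finrank B (IntermediateField.adjoin B A)

/-- `pdeg A = k`, i.e. `[F^p(A) : F^p] = p ^ k`. -/
def pDegEq (A : Set F) (k : ℕ) : Prop :=
  relDeg F (pClosure F p ∅) A = p ^ k

/-- A finite family `a : Fin n → F` is `p`-independent if `[F^p(a₁,…,aₙ) : F^p] = pⁿ`. -/
def pIndep {n : ℕ} (a : Fin n → F) : Prop :=
  pDegEq F p (Set.range a) n

/-- The exterior algebra of the absolute differential forms of `F`; the spaces `Ωⁿ(F)`
are its graded pieces and the wedge product is its multiplication. -/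
abbrev ExtOmega := ExteriorAlgebra F (Ω[F⁄ℤ])

/-- The differential `d a` of an element `a : F`, viewed in the exterior algebra. -/
def dform (a : F) : ExtOmega F :=
  ExteriorAlgebra.ι F (KaehlerDifferential.D ℤ F a)

/-- The space `Ωⁿ(F)` of `n`-differential forms, as a submodule of the exterior algebra;
it is `0` for `n < 0`. -/
def OmegaPow (n : ℤ) : Submodule F (ExtOmega F) :=
  if 0 ≤ n then ⋀[F]^(n.toNat) (Ω[F⁄ℤ]) else ⊥

/-- The wedge product `d a₁ ∧ … ∧ d aₙ` of the differentials of a family. -/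
def dwedge {n : ℕ} (a : Fin n → F) : ExtOmega F :=
  (List.ofFn fun i => dform F (a i)).prod

/-- The annihilator `annΩ^n_F(U)` of a set `U` of differential forms. -/
def annOmega (n : ℕ) (U : Set (ExtOmega F)) : Submodule F (ExtOmega F) :=
  OmegaPow F n ⊓ ⨅ u ∈ U, LinearMap.ker (LinearMap.mulRight F u)

/-- The logarithmic differential form `(dx₁/x₁) ∧ … ∧ (dxₙ/xₙ)`. -/
def logForm {n : ℕ} (x : Fin n → F) : ExtOmega F :=
  (List.ofFn fun i => ExteriorAlgebra.ι F ((x i)⁻¹ • KaehlerDifferential.D ℤ F (x i))).prod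

/-- The group `ν_n(F)`, additively generated by the logarithmic differential forms;
it is `0` for `n < 0`. -/
def nuPow (n : ℤ) : AddSubgroup (ExtOmega F) :=
  if 0 ≤ n then
    AddSubgroup.closure
      {ω | ∃ x : Fin n.toNat → F, (∀ i, x i ≠ 0) ∧ ω = logForm F x}
  else ⊥

/-- The annihilator `ann ν^n_F(U)`. -/
def annNu (n : ℕ) (U : Set (ExtOmega F)) : AddSubgroup (ExtOmega F) :=
  (annOmega F n U).toAddSubgroup ⊓ nuPow F n

/-- `η ∧ W` for a form `η` and a subspace `W`. -/
def wedgeL (η : ExtOmega F) (W : Submodule F (ExtOmega F)) : Submodule F (ExtOmega F) :=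
  W.map (LinearMap.mulLeft F η)

/-- The set `dS₁ ∧ … ∧ dSᵣ` for sets `S₁, …, Sᵣ ⊆ F`. -/
def dSet {r : ℕ} (S : Fin r → Set F) : Set (ExtOmega F) :=
  {ω | ∃ s : Fin r → F, (∀ i, s i ∈ S i) ∧ ω = dwedge F s}

/-- The additive subgroup `[dy₁/y₁ ∧ … ∧ dy_t/y_t ∣ yᵢ ∈ K^*] ∧ ν_m(F)` of `Ωⁿ(F)`
(for `n = t + m`). -/
def logWedgeNu (K : Set F) (t : ℕ) (m : ℤ) : AddSubgroup (ExtOmega F) :=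
  AddSubgroup.closure
    {ω | ∃ y : Fin t → F, (∀ i, y i ∈ K ∧ y i ≠ 0) ∧
      ∃ χ ∈ nuPow F m, ω = logForm F y * χ}

variable (E : Type) [Field E] [Algebra F E]

/-- The restriction map `Ω(F) → Ω(E)` on exterior algebras of differential forms,
induced by the inclusion `F ⊆ E`; it sends `d a` to `d a` and `x dа₁ ∧ … ∧ daₙ` to
the corresponding form over `E`. -/
def resMap : ExtOmega F →+* ExtOmega E :=
  letI : Algebra F (ExtOmega E) :=
    ((algebraMap E (ExtOmega E)).comp (algebraMap F E)).toAlgebra'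
      (fun c x => Algebra.commutes (algebraMap F E c) x)
  (ExteriorAlgebra.lift F ⟨{
      toFun := fun w =>
        ExteriorAlgebra.ι E (KaehlerDifferential.map ℤ ℤ F E w)
      map_add' := fun x y => by simp
      map_smul' := fun c x => by
        simp only [map_smul, RingHom.id_apply]
        rw [← algebraMap_smul E c (KaehlerDifferential.map ℤ ℤ F E x), map_smul,
          Algebra.smul_def, Algebra.smul_def]
        rfl },
    fun m => ExteriorAlgebra.ι_sq_zero _⟩).toRingHom

/-- The kernel `Ωⁿ(E/F)` of the restriction map `Ωⁿ(F) → Ωⁿ(E)`. -/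
def OmegaKer (n : ℕ) : Set (ExtOmega F) :=
  {ω | ω ∈ OmegaPow F n ∧ resMap F E ω = 0}

/-- The kernel `ν_n(E/F) = Ωⁿ(E/F) ∩ ν_n(F)`. -/
def nuKer (n : ℕ) : Set (ExtOmega F) :=
  OmegaKer F E n ∩ (nuPow F n : Set (ExtOmega F))

end Preamble

theorem choose_prime_sub_one_cast {R : Type*} [Ring R] (p : ℕ) [Fact p.Prime] [CharP R p] (i : ℕ)
    (hi : i < p) : ((p - 1).choose i : R) = (-1) ^ i := by
  have hp : p - 1 + 1 = p := Nat.sub_add_cancel (Fact.out : p.Prime).one_le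
  induction i with
  | zero => simp
  | succ i ih =>
    have h : p.choose (i + 1) = (p - 1).choose i + (p - 1).choose (i + 1) := by
      conv_lhs => rw [← hp]
      exact Nat.choose_succ_succ (p - 1) i
    have h0 : ((p.choose (i + 1) : ℕ) : R) = 0 :=
      (CharP.cast_eq_zero_iff R p _).2
        ((Fact.out : p.Prime).dvd_choose_self (Nat.succ_ne_zero i) hi)
    rw [h, Nat.cast_add, ih (by omega)] at h0
    rw [pow_succ, mul_neg_one]
    exact eq_neg_of_add_eq_zero_right h0

theorem Commute.sub_pow_prime_sub_one {R : Type*} [Ring R] (p : ℕ) [Fact p.Prime] [CharP R p]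
    {x y : R} (h : Commute x y) :
    (x - y) ^ (p - 1) = ∑ i ∈ Finset.range p, x ^ i * y ^ (p - 1 - i) := by
  have hp : p - 1 + 1 = p := Nat.sub_add_cancel (Fact.out : p.Prime).one_le
  rw [sub_eq_add_neg, h.neg_right.add_pow, hp]
  refine Finset.sum_congr rfl fun i hi => ?_
  have hi' : i < p := Finset.mem_range.1 hi
  rw [choose_prime_sub_one_cast p i hi', neg_pow y, mul_assoc, mul_assoc]
  have h1 : (-1 : R) ^ (p - 1 - i) * (y ^ (p - 1 - i) * (-1) ^ i) = y ^ (p - 1 - i) := by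
    rw [((Commute.neg_one_right y).pow_pow _ _).eq, ← mul_assoc, ← pow_add,
      Nat.sub_add_cancel (by omega)]
    rcases (Fact.out : p.Prime).eq_two_or_odd' with h2 | h2
    · subst h2
      have : (-1 : R) = 1 := by
        have h3 : ((2 : ℕ) : R) = 0 := CharP.cast_eq_zero R 2
        have h4 : (1 : R) + 1 = 0 := by rw [one_add_one_eq_two]; exact_mod_cast h3
        exact neg_eq_of_add_eq_zero_left h4
      simp [this]
    · rw [(Nat.Odd.sub_odd h2 odd_one).neg_one_pow, one_mul]
  rw [h1]

open Polynomial in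
theorem Polynomial.derivative_pow_eq_sum {R : Type*} [Semiring R] (u : R[X]) (n : ℕ) :
    derivative (u ^ n) = ∑ i ∈ Finset.range n, u ^ i * derivative u * u ^ (n - 1 - i) := by
  induction n with
  | zero => simp
  | succ n ih =>
    rw [pow_succ, derivative_mul, ih, Finset.sum_range_succ, Finset.sum_mul]
    congr 1
    · refine Finset.sum_congr rfl fun i hi => ?_
      have : i < n := Finset.mem_range.1 hi
      rw [mul_assoc, ← pow_succ]
      congr 2
      omega
    · simp

open Polynomial in
/-- Jacobson's formula for `(x + y) ^ p` when the iterated commutators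
`z k = (ad x) ^ k y` all commute with `y`. -/
theorem add_pow_prime_of_commutators {R : Type*} [Ring R] (p : ℕ) [hp : Fact p.Prime] [CharP R p]
    (x y : R) (z : ℕ → R) (h0 : z 0 = y) (hz : ∀ k, z (k + 1) = x * z k - z k * x)
    (hc : ∀ k, y * z k = z k * y) :
    (x + y) ^ p = x ^ p + y ^ p + z (p - 1) := by
  have hp1 : p - 1 + 1 = p := Nat.sub_add_cancel hp.out.one_le
  set u : R[X] := C x + X * C y with hu
  have hdu : derivative u = C y := by simp [hu]
  have had : ∀ k, ((LinearMap.mulLeft ℤ u - LinearMap.mulRight ℤ u) ^ k) (C y) = C (z k) := by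
    intro k
    induction k with
    | zero => simp [h0]
    | succ k ih =>
      rw [pow_succ', Module.End.mul_apply, ih, hz]
      simp only [LinearMap.sub_apply, LinearMap.mulLeft_apply, LinearMap.mulRight_apply, hu,
        add_mul, mul_add, map_sub, map_mul]
      rw [mul_assoc X, ← C_mul (a := y), hc k, ← mul_assoc (C (z k)), ← X_mul_C, mul_assoc X,
        ← C_mul (a := z k) (b := y)]
      abel
  have : CharP (Module.End ℤ R[X]) p := by
    refine charP_of_injective_ringHom (R := R[X]) (f := (Algebra.lmul ℤ R[X]).toRingHom) ?_ p
    exact Algebra.lmul_injective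
  have hder : derivative (u ^ p) = C (z (p - 1)) := by
    rw [Polynomial.derivative_pow_eq_sum, hdu, ← had,
      (LinearMap.commute_mulLeft_right (R := ℤ) u u).sub_pow_prime_sub_one p, LinearMap.sum_apply]
    refine Finset.sum_congr rfl fun i _ => ?_
    rw [Module.End.mul_apply, LinearMap.pow_mulLeft, LinearMap.pow_mulRight]
    simp [mul_assoc]
  have hcoef : ∀ k, (u ^ p).coeff (k + 1) * (k + 1) = if k = 0 then z (p - 1) else 0 := by
    intro k
    rw [← coeff_derivative, hder, coeff_C]
  have hdeg : u.natDegree ≤ 1 := by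
    refine (natDegree_add_le _ _).trans (max_le (by simp) ?_)
    refine natDegree_mul_le.trans ?_
    simp [natDegree_X_le]
  have hdegp : (u ^ p).natDegree < p + 1 := by
    refine Nat.lt_succ_of_le (natDegree_pow_le.trans ?_)
    simpa using Nat.mul_le_mul_left p hdeg
  have hc1 : ∀ r : R, Commute (RingHom.id R r) 1 := fun r => Commute.one_right r
  have hc0 : ∀ r : R, Commute (RingHom.id R r) 0 := fun r => Commute.zero_right r
  have hev1 : (u ^ p).eval 1 = (x + y) ^ p := by
    change eval₂RingHom' (RingHom.id R) 1 hc1 (u ^ p) = _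
    rw [map_pow]
    congr 1
    change u.eval 1 = _
    simp [hu]
  have hev0 : (u ^ p).coeff 0 = x ^ p := by
    rw [coeff_zero_eq_eval_zero]
    change eval₂RingHom' (RingHom.id R) 0 hc0 (u ^ p) = _
    rw [map_pow]
    congr 1
    change u.eval 0 = _
    simp [hu]
  have htop : (u ^ p).coeff p = y ^ p := by
    have := coeff_pow_of_natDegree_le (m := p) hdeg
    rw [mul_one] at this
    rw [this]
    simp [hu]
  have hmid : ∀ k ∈ Finset.range (p - 1), k ≠ 0 → (u ^ p).coeff (k + 1) = 0 := by
    intro k hk hk0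
    have hk' := Finset.mem_range.1 hk
    have h1 := hcoef k
    rw [if_neg hk0] at h1
    have hunit : IsUnit ((k + 1 : ℕ) : ZMod p) := by
      rw [ZMod.isUnit_iff_coprime]
      exact (Nat.coprime_of_lt_prime (Nat.succ_ne_zero k) (by omega) hp.out).symm
    have h2 := hunit.map (ZMod.castHom (dvd_refl p) R)
    rw [map_natCast, Nat.cast_add, Nat.cast_one] at h2
    exact (h2.mul_left_eq_zero).1 h1
  have hone : (u ^ p).coeff 1 = z (p - 1) := by simpa using hcoef 0
  rw [← hev1, eval_eq_sum_range' hdegp, Finset.sum_range_succ, htop]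
  simp only [one_pow, mul_one]
  have hsum : ∑ i ∈ Finset.range p, (u ^ p).coeff i = x ^ p + z (p - 1) := by
    have h := Finset.sum_range_succ' (fun i => (u ^ p).coeff i) (p - 1)
    rw [hp1] at h
    rw [h, hev0, add_comm]
    congr 1
    rw [Finset.sum_eq_single_of_mem 0 _ hmid, hone]
    exact Finset.mem_range.2 (by have := hp.out.two_le; omega)
  rw [hsum]
  abel

section Toral

variable {F : Type*} [Field F] (p : ℕ)

theorem charP_end_int (R : Type*) [Ring R] [CharP R p] : CharP (Module.End ℤ R) p :=
  charP_of_injective_ringHom (R := R) (f := (Algebra.lmul ℤ R).toRingHom)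
    Algebra.lmul_injective p

theorem Derivation.toLinearMap_pow_apply (D : Derivation ℤ F F) (k : ℕ) (x : F) :
    ((D : F →ₗ[ℤ] F) ^ k) x = D^[k] x := by
  rw [Module.End.pow_apply]
  rfl

theorem Derivation.iterate_prime_mul [hpr : Fact p.Prime] [CharP F p] (D : Derivation ℤ F F) (x y : F) :
    D^[p] (x * y) = D^[p] x * y + x * D^[p] y := by
  have := charP_end_int p F
  have := charP_end_int p (Module.End ℤ F)
  set δ : Module.End ℤ F := (D : F →ₗ[ℤ] F) with hδ
  have had : ∀ k, ((LinearMap.mulLeft ℤ δ - LinearMap.mulRight ℤ δ) ^ k) (LinearMap.mulLeft ℤ x)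
      = LinearMap.mulLeft ℤ (D^[k] x) := by
    intro k
    induction k with
    | zero => rfl
    | succ k ih =>
      rw [pow_succ', Module.End.mul_apply, ih, Function.iterate_succ_apply']
      ext z
      simp [hδ, mul_comm]
  have h := had p
  rw [sub_pow_char_of_commute (p := p) (h := LinearMap.commute_mulLeft_right (R := ℤ) δ δ),
    LinearMap.pow_mulLeft, LinearMap.pow_mulRight] at h
  have h2 := LinearMap.congr_fun h y
  simp only [LinearMap.sub_apply, LinearMap.mulLeft_apply, LinearMap.mulRight_apply,
    Module.End.mul_apply] at h2
  rw [Derivation.toLinearMap_pow_apply, Derivation.toLinearMap_pow_apply] at h2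
  linear_combination h2

/-- Jacobson's formula for the operator `D + c`. -/
theorem Derivation.add_mul_iterate_prime [hpr : Fact p.Prime] [CharP F p] (D : Derivation ℤ F F) (c y : F) :
    (fun x => D x + c * x)^[p] y = D^[p] y + c ^ p * y + D^[p - 1] c * y := by
  have := charP_end_int p F
  have h := add_pow_prime_of_commutators p (D : F →ₗ[ℤ] F) (LinearMap.mulLeft ℤ c)
    (fun k => LinearMap.mulLeft ℤ (D^[k] c)) rfl
    (fun k => by
      ext z
      rw [Function.iterate_succ_apply']
      simp [mul_comm])
    (fun k => by ext z; simp [mul_left_comm])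
  have h2 := LinearMap.congr_fun h y
  simp only [LinearMap.add_apply, LinearMap.mulLeft_apply, LinearMap.pow_mulLeft,
    Module.End.pow_apply] at h2
  exact h2

theorem Derivation.map_pow_char [CharP F p] (D : Derivation ℤ F F) (x : F) : D (x ^ p) = 0 := by
  rw [Derivation.leibniz_pow, ← Nat.cast_smul_eq_nsmul F]
  simp

/-- The projection of `F` onto the constants of a derivation `D` with `D ^ p = D`. -/
def constProj (D : Derivation ℤ F F) : F →ₗ[ℤ] F := LinearMap.id - (D : F →ₗ[ℤ] F) ^ (p - 1)

theorem constProj_apply (D : Derivation ℤ F F) (x : F) :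
    constProj p D x = x - D^[p - 1] x := by
  rw [constProj, LinearMap.sub_apply, Derivation.toLinearMap_pow_apply, LinearMap.id_apply]

variable {p} {D D' : Derivation ℤ F F}

theorem iterate_prime_sub_one [hpr : Fact p.Prime] (hD : ∀ x, D^[p] x = D x) (x : F) : D (D^[p - 1] x) = D x := by
  rw [← Function.iterate_succ_apply' (f := D), Nat.succ_eq_add_one,
    Nat.sub_add_cancel hpr.out.one_le, hD]

theorem deriv_constProj [hpr : Fact p.Prime] (hD : ∀ x, D^[p] x = D x) (x : F) : D (constProj p D x) = 0 := by
  rw [constProj_apply, map_sub, iterate_prime_sub_one hD, sub_self]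

theorem constProj_comm (h : ∀ x, D' (D x) = D (D' x)) (x : F) :
    D' (constProj p D x) = constProj p D (D' x) := by
  have hc : Function.Commute D' D := h
  rw [constProj_apply, constProj_apply, map_sub, (hc.iterate_right (p - 1)).eq]

theorem constProj_deriv [hpr : Fact p.Prime] (hD : ∀ x, D^[p] x = D x) (x : F) : constProj p D (D x) = 0 := by
  rw [← constProj_comm (fun _ => rfl), deriv_constProj hD]

theorem constProj_mul (z x : F) (hz : D z = 0) : constProj p D (z * x) = z * constProj p D x := by
  have : ∀ k, D^[k] (z * x) = z * D^[k] x := by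
    intro k
    induction k with
    | zero => rfl
    | succ k ih =>
      rw [Function.iterate_succ_apply', ih, Function.iterate_succ_apply', Derivation.leibniz, hz]
      simp
  rw [constProj_apply, constProj_apply, this, mul_sub]

theorem constProj_of_const [hpr : Fact p.Prime] (z : F) (hz : D z = 0) : constProj p D z = z := by
  have hp : p - 1 = (p - 2) + 1 := by have := hpr.out.two_le; omega
  rw [constProj_apply, hp, Function.iterate_succ_apply, hz,
    Function.iterate_fixed (map_zero D), sub_zero]

theorem pow_eq_constProj_of_log [hpr : Fact p.Prime] [CharP F p] (hD : ∀ x, D^[p] x = D x) (x : F) (hx : x ≠ 0) :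
    (x⁻¹ * D x) ^ p = constProj p D (x⁻¹ * D x) := by
  have h := D.add_mul_iterate_prime p (x⁻¹ * D x) 1
  have hconj : ∀ k y, (fun z => D z + x⁻¹ * D x * z)^[k] y = x⁻¹ * D^[k] (x * y) := by
    intro k
    induction k with
    | zero => intro y; simp [hx]
    | succ k ih =>
      intro y
      rw [Function.iterate_succ_apply, ih, Function.iterate_succ_apply]
      congr 2
      rw [Derivation.leibniz]
      simp only [smul_eq_mul]
      field_simp
  rw [hconj, hD 1, hD] at h
  simp only [mul_one, Derivation.map_one_eq_zero, zero_add] at h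
  rw [constProj_apply]
  linear_combination -h

open Polynomial in
theorem exists_eigenvector_of_prod [hpr : Fact p.Prime] {V : Type*} [AddCommGroup V] [Module (ZMod p) V]
    (T : Module.End (ZMod p) V) (W : AddSubgroup V) (hW : ∀ v ∈ W, T v ∈ W) (s : Finset (ZMod p))
    (v : V) (hv : v ∈ W) (hv0 : v ≠ 0)
    (h : aeval T (∏ i ∈ s, (X - C i)) v = 0) : ∃ i : ZMod p, ∃ y ∈ W, y ≠ 0 ∧ T y = i • y := by
  induction s using Finset.induction_on generalizing v with
  | empty => simp at h; exact absurd h hv0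
  | insert i s hi ih =>
    rw [Finset.prod_insert hi, mul_comm, map_mul, Module.End.mul_apply] at h
    by_cases h0 : aeval T (X - C i) v = 0
    · refine ⟨i, v, hv, hv0, ?_⟩
      simpa [sub_eq_zero] using h0
    · refine ih _ ?_ h0 h
      have : i • v ∈ W := by
        rw [← ZMod.natCast_zmod_val i, Nat.cast_smul_eq_nsmul]
        exact W.nsmul_mem hv _
      simpa using W.sub_mem (hW v hv) this

open Polynomial in
theorem prod_X_sub_C_zmod [hpr : Fact p.Prime] : ∏ i : ZMod p, (X - C i) = (X ^ p - X : (ZMod p)[X]) := by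
  have hroots := FiniteField.roots_X_pow_card_sub_X (ZMod p)
  rw [ZMod.card] at hroots
  have hdeg : (X ^ p - X : (ZMod p)[X]).natDegree = p :=
    FiniteField.X_pow_card_sub_X_natDegree_eq (ZMod p) hpr.out.one_lt
  have h := prod_multiset_X_sub_C_of_monic_of_roots_card_eq (p := (X ^ p - X : (ZMod p)[X]))
    (monic_X_pow_sub (by rw [degree_X]; exact_mod_cast hpr.out.one_lt))
    (by rw [hroots, hdeg]; simp)
  rw [hroots] at h
  exact h

open Polynomial in
theorem exists_log_of_pow_eq_constProj [hpr : Fact p.Prime] [CharP F p] (hD : ∀ x, D^[p] x = D x) (W : Subfield F)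
    (hW : ∀ x ∈ W, D x ∈ W) (b : F) (hb : b ∈ W) (hb0 : b ≠ 0) (hDb : D b = b)
    (c : F) (hc : c ∈ W) (hcp : c ^ p = constProj p D c) :
    ∃ y ∈ W, y ≠ 0 ∧ D y = c * y := by
  let := ZMod.algebra F p
  let T : Module.End (ZMod p) F :=
    (AddMonoidHom.toZModLinearMap p ((D : F →+ F) + AddMonoidHom.mulLeft (-c)))
  have hT : ∀ x, T x = D x + -c * x := fun x => rfl
  have hTp : T ^ p = T := by
    ext x
    rw [Module.End.pow_apply]
    have h := D.add_mul_iterate_prime p (-c) x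
    have h1 : (fun x => D x + -c * x) = T := funext fun x => (hT x).symm
    rw [h1] at h
    rw [h, hT, hD]
    have h2 : D^[p - 1] (-c) = - D^[p - 1] c := iterate_map_neg D _ _
    have h3 : (-c) ^ p = - c ^ p := by
      have := sub_pow_char (p := p) (0 : F) c
      rwa [zero_sub, zero_pow hpr.out.ne_zero, zero_sub] at this
    rw [h2, h3, hcp, constProj_apply]
    ring
  have hprod : aeval T (∏ i : ZMod p, (X - C i)) (1 : F) = 0 := by
    rw [prod_X_sub_C_zmod]
    simp [hTp]
  obtain ⟨i, y, hy, hy0, hyT⟩ := exists_eigenvector_of_prod T W.toAddSubgroup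
    (fun v hv => W.add_mem (hW v hv) (W.mul_mem (W.neg_mem hc) hv)) Finset.univ 1 W.one_mem
    one_ne_zero hprod
  have hbi : ∀ k : ℕ, D (b ^ k) = k * b ^ k := by
    intro k
    rw [Derivation.leibniz_pow, hDb]
    rcases k with _ | k
    · simp
    · simp [pow_succ]
  refine ⟨y * b ^ (-i).val, W.mul_mem hy (W.pow_mem hb _), mul_ne_zero hy0 (pow_ne_zero _ hb0), ?_⟩
  rw [Derivation.leibniz, hbi]
  rw [hT, Algebra.smul_def] at hyT
  have h1 : (((-i).val : ℕ) : F) = - algebraMap (ZMod p) F i := by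
    rw [← map_neg, ← map_natCast (algebraMap (ZMod p) F), ZMod.natCast_zmod_val]
  rw [h1]
  simp only [smul_eq_mul]
  linear_combination b ^ (-i).val * hyT

end Toral

section ListForms

variable {F I : Type*} [Field F]

/-- The coefficient at `t` of the wedge product of the `1`-form with coefficients `c` with the
form with coefficients `φ`. -/
def listWedge (c : I → F) : List I → (List I → F) → F
  | [], _ => 0
  | j :: t, φ => c j * φ t - listWedge c t fun u => φ (j :: u)

/-- The coefficient at `t` of the exterior derivative of the form with coefficients `φ`. -/
def listDeriv (D : I → Derivation ℤ F F) : List I → (List I → F) → F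
  | [], _ => 0
  | j :: t, φ => D j (φ t) - listDeriv D t fun u => φ (j :: u)

theorem listWedge_add_left (c c' : I → F) (t : List I) (φ : List I → F) :
    listWedge (fun i => c i + c' i) t φ = listWedge c t φ + listWedge c' t φ := by
  induction t generalizing φ with
  | nil => simp [listWedge]
  | cons j t ih => simp only [listWedge, ih]; ring

theorem listWedge_sub (c : I → F) (t : List I) (φ ψ : List I → F) :
    listWedge c t (fun u => φ u - ψ u) = listWedge c t φ - listWedge c t ψ := by
  induction t generalizing φ ψ with
  | nil => simp [listWedge]
  | cons j t ih => simp only [listWedge, ih]; ring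

theorem listWedge_smul (c : I → F) (t : List I) (x : F) (φ : List I → F) :
    listWedge c t (fun u => x * φ u) = x * listWedge c t φ := by
  induction t generalizing φ with
  | nil => simp [listWedge]
  | cons j t ih => simp only [listWedge, ih]; ring

theorem listWedge_zero (c : I → F) (t : List I) : listWedge c t (fun _ => 0) = 0 := by
  simpa using listWedge_smul c t 0 (fun _ => 0)

theorem listWedge_congr {c c' : I → F} {t : List I} (h : ∀ j ∈ t, c j = c' j) (φ : List I → F) :
    listWedge c t φ = listWedge c' t φ := by
  induction t generalizing φ with
  | nil => rfl
  | cons j t ih =>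
    simp only [listWedge]
    rw [h j (by simp), ih fun k hk => h k (by simp [hk])]

theorem listWedge_eq_zero {c : I → F} {t : List I} (h : ∀ j ∈ t, c j = 0) (φ : List I → F) :
    listWedge c t φ = 0 := by
  induction t generalizing φ with
  | nil => rfl
  | cons j t ih =>
    simp only [listWedge]
    rw [h j (by simp), ih fun k hk => h k (by simp [hk])]
    simp

theorem exists_of_listWedge_ne_zero {c : I → F} {t : List I} {φ : List I → F}
    (h : listWedge c t φ ≠ 0) : ∃ k t', t.Perm (k :: t') ∧ c k ≠ 0 ∧ φ t' ≠ 0 := by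
  induction t generalizing φ with
  | nil => exact absurd rfl h
  | cons j t ih =>
    by_cases h1 : c j * φ t = 0
    · rw [listWedge, h1, zero_sub, neg_ne_zero] at h
      obtain ⟨k, t', hp, hk, ht'⟩ := ih h
      exact ⟨k, j :: t', (hp.cons j).trans (List.Perm.swap k j t'), hk, ht'⟩
    · exact ⟨j, t, List.Perm.refl _, left_ne_zero_of_mul h1, right_ne_zero_of_mul h1⟩

variable {D : I → Derivation ℤ F F}

theorem listDeriv_add (t : List I) (φ ψ : List I → F) :
    listDeriv D t (fun u => φ u + ψ u) = listDeriv D t φ + listDeriv D t ψ := by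
  induction t generalizing φ ψ with
  | nil => simp [listDeriv]
  | cons j t ih => simp only [listDeriv, ih, map_add]; ring

theorem listDeriv_neg (t : List I) (φ : List I → F) :
    listDeriv D t (fun u => - φ u) = - listDeriv D t φ := by
  induction t generalizing φ with
  | nil => simp [listDeriv]
  | cons j t ih => simp only [listDeriv, ih, map_neg]; ring

theorem listDeriv_sub (t : List I) (φ ψ : List I → F) :
    listDeriv D t (fun u => φ u - ψ u) = listDeriv D t φ - listDeriv D t ψ := by
  simp only [sub_eq_add_neg, listDeriv_add, listDeriv_neg]

theorem listDeriv_smul (t : List I) (x : F) (φ : List I → F) :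
    listDeriv D t (fun u => x * φ u) =
      x * listDeriv D t φ + listWedge (fun k => D k x) t φ := by
  induction t generalizing φ with
  | nil => simp [listDeriv, listWedge]
  | cons j t ih =>
    simp only [listDeriv, listWedge, ih, Derivation.leibniz, smul_eq_mul]
    ring

theorem deriv_listWedge (δ : Derivation ℤ F F) (c : I → F) (t : List I) (φ : List I → F) :
    δ (listWedge c t φ) =
      listWedge (fun k => δ (c k)) t φ + listWedge c t (fun u => δ (φ u)) := by
  induction t generalizing φ with
  | nil => simp [listWedge]
  | cons j t ih =>
    simp only [listWedge, ih, map_sub, Derivation.leibniz, smul_eq_mul]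
    ring

theorem listDeriv_listWedge {c : I → F} (hc : ∀ j k, D j (c k) = D k (c j)) (t : List I)
    (φ : List I → F) :
    listDeriv D t (fun u => listWedge c u φ) = - listWedge c t fun u => listDeriv D u φ := by
  induction t generalizing φ with
  | nil => simp [listDeriv, listWedge]
  | cons j t ih =>
    simp only [listDeriv, listWedge]
    rw [listDeriv_sub, listDeriv_smul, ih, deriv_listWedge, listWedge_sub,
      listWedge_congr (fun k _ => hc j k)]
    ring

theorem deriv_list_eq_zero_wedge {c : I → F} (hc : ∀ j k, D j (c k) = D k (c j))
    {φ : List I → F} (h : ∀ t, listDeriv D t φ = 0) (t : List I) :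
    listDeriv D t (fun u => listWedge c u φ) = 0 := by
  rw [listDeriv_listWedge hc]
  simp only [h, listWedge_zero, neg_zero]

variable (p : ℕ)

/-- The composition of the projections onto the constants of `D j`, for `j` in a list. -/
def projList (D : I → Derivation ℤ F F) : List I → F →ₗ[ℤ] F
  | [] => LinearMap.id
  | j :: t => constProj p (D j) ∘ₗ projList D t

@[simp]
theorem projList_nil (x : F) : projList p D [] x = x := rfl

theorem projList_cons (j : I) (t : List I) (x : F) :
    projList p D (j :: t) x = constProj p (D j) (projList p D t x) := rfl

theorem projList_append (s t : List I) (x : F) :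
    projList p D (s ++ t) x = projList p D s (projList p D t x) := by
  induction s with
  | nil => rfl
  | cons j s ih => rw [List.cons_append, projList_cons, ih, projList_cons]

variable {p} [hpr : Fact p.Prime] [CharP F p]

theorem projList_pow_mul (t : List I) (z x : F) :
    projList p D t (z ^ p * x) = z ^ p * projList p D t x := by
  induction t with
  | nil => rfl
  | cons j t ih =>
    rw [projList_cons, ih, constProj_mul _ _ (Derivation.map_pow_char p _ _), projList_cons]

theorem deriv_projList (hcomm : ∀ i j x, D i (D j x) = D j (D i x))
    (j : I) (t : List I) (x : F) :
    D j (projList p D t x) = projList p D t (D j x) := by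
  induction t with
  | nil => rfl
  | cons k t ih =>
    rw [projList_cons, constProj_comm (hcomm j k), ih, projList_cons]

theorem projList_listDeriv_append (hcomm : ∀ i j x, D i (D j x) = D j (D i x)) (hD : ∀ i x, (D i)^[p] x = D i x)
    (u v : List I) (φ : List I → F)
    (h : ∀ k u', u.Perm (k :: u') → φ (u' ++ v) = 0) :
    projList p D v (listDeriv D (u ++ v) φ) = 0 := by
  induction u generalizing φ with
  | nil =>
    clear h
    rw [List.nil_append]
    induction v generalizing φ with
    | nil => simp [listDeriv]
    | cons j v ih =>
      rw [listDeriv, map_sub, projList_cons, projList_cons, ih, map_zero, sub_zero,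
        ← deriv_projList hcomm, constProj_deriv (hD j)]
  | cons k u ih =>
    rw [List.cons_append, listDeriv, map_sub, h k u (List.Perm.refl _), map_zero, map_zero,
      zero_sub, neg_eq_zero]
    refine ih _ fun k' u' hu' => ?_
    exact h k' (k :: u') ((hu'.cons k).trans (List.Perm.swap _ _ _))

theorem projList_listDeriv (hcomm : ∀ i j x, D i (D j x) = D j (D i x)) (hD : ∀ i x, (D i)^[p] x = D i x)
    (v : List I) (φ : List I → F) :
    projList p D v (listDeriv D v φ) = 0 :=
  projList_listDeriv_append hcomm hD [] v φ fun k u' h => by simpa using h.length_eq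

/-- A closed family satisfying the Cartier condition is, on any finite list of indices, the sum
of its `p`-th power and an exact family. -/
theorem exists_primitive (hcomm : ∀ i j x, D i (D j x) = D j (D i x)) (hD : ∀ i x, (D i)^[p] x = D i x)
    {c : I → F} (hc : ∀ j k, D j (c k) = D k (c j))
    (hcp : ∀ j, c j ^ p = constProj p (D j) (c j)) (t : List I) :
    ∃ z, ∀ j ∈ t, c j = c j ^ p + D j z := by
  induction t with
  | nil => exact ⟨0, by simp⟩
  | cons k t ih =>
    obtain ⟨z, hz⟩ := ih
    have hp : p - 1 = (p - 2) + 1 := by have := hpr.out.two_le; omega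
    have hcj : ∀ i j, D i (c j ^ p) = 0 := fun i j => Derivation.map_pow_char p _ _
    refine ⟨z + (D k)^[p - 2] (c k - c k ^ p - D k z), fun j hj => ?_⟩
    have hcm : Function.Commute (D j) (D k) := hcomm j k
    have hswap : D j (c k - c k ^ p - D k z) = D k (c j - c j ^ p - D j z) := by
      simp only [map_sub, hcj, hc j k, hcomm j k]
    rw [map_add, (hcm.iterate_right (p - 2)).eq, hswap, ← Function.iterate_succ_apply,
      Nat.succ_eq_add_one, ← hp]
    by_cases hjt : j ∈ t
    · have h0 : c j - c j ^ p - D j z = 0 := by linear_combination hz j hjt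
      rw [h0, iterate_map_zero, add_zero]
      exact hz j hjt
    · have hjk : j = k := (List.mem_cons.1 hj).resolve_right hjt
      subst hjk
      have h1 : constProj p (D j) (c j - c j ^ p - D j z) = 0 := by
        rw [map_sub, map_sub, constProj_of_const _ (hcj j j), constProj_deriv (hD j), hcp j]
        simp
      rw [constProj_apply] at h1
      linear_combination h1

theorem projList_constProj (hcomm : ∀ i j x, D i (D j x) = D j (D i x))
    (j : I) (t : List I) (x : F) :
    projList p D t (constProj p (D j) x) = constProj p (D j) (projList p D t x) := by
  have h : Function.Semiconj (projList p D t) (D j) (D j) :=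
    fun y => (deriv_projList hcomm j t y).symm
  rw [constProj_apply, constProj_apply, map_sub, (h.iterate_right (p - 1)).eq]

theorem projList_wedge_pow (hcomm : ∀ i j x, D i (D j x) = D j (D i x))
    (c : I → F) (t v : List I) (φ : List I → F)
    (h : ∀ u, projList p D (v ++ u) (φ u) = φ u ^ p) :
    projList p D (v ++ t) (listWedge (fun j => c j ^ p) t φ) = listWedge c t φ ^ p := by
  induction t generalizing v φ with
  | nil => simp [listWedge, hpr.out.ne_zero]
  | cons j t ih =>
    rw [listWedge, listWedge, map_sub, sub_pow_char (p := p), mul_pow, projList_pow_mul]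
    have h1 : v ++ j :: t = v ++ [j] ++ t := by simp
    congr 2
    · rw [projList_append, projList_cons, projList_constProj hcomm, ← projList_append, h t,
        constProj_of_const _ (Derivation.map_pow_char p _ _)]
    · rw [h1]
      exact ih (v ++ [j]) _ fun u => by simpa using h (j :: u)

theorem projList_listWedge (hcomm : ∀ i j x, D i (D j x) = D j (D i x)) (hD : ∀ i x, (D i)^[p] x = D i x)
    {c : I → F} (hc : ∀ j k, D j (c k) = D k (c j))
    (hcp : ∀ j, c j ^ p = constProj p (D j) (c j)) {φ : List I → F}
    (h : ∀ t, listDeriv D t φ = 0) (hp : ∀ t, projList p D t (φ t) = φ t ^ p) (t : List I) :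
    projList p D t (listWedge c t φ) = listWedge c t φ ^ p := by
  obtain ⟨z, hz⟩ := exists_primitive hcomm hD hc hcp t
  have h1 : listWedge (fun k => D k z) t φ = listDeriv D t (fun u => z * φ u) := by
    rw [listDeriv_smul, h, mul_zero, zero_add]
  have h2 := projList_wedge_pow hcomm c t [] φ hp
  rw [List.nil_append] at h2
  conv_lhs => rw [listWedge_congr hz, listWedge_add_left, h1, map_add, h2,
    projList_listDeriv hcomm hD, add_zero]

end ListForms

section ExtCoeff

open Module

variable {F V I : Type*} [Field F] [AddCommGroup V] [Module F V] (β : Basis I F V)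

/-- The coefficient of an element of the exterior algebra at a list of basis indices. -/
noncomputable def extCoeff : List I → ExteriorAlgebra F V →ₗ[F] F
  | [] => (ExteriorAlgebra.algebraMapInv : ExteriorAlgebra F V →ₐ[F] F).toLinearMap
  | j :: t => extCoeff t ∘ₗ CliffordAlgebra.contractLeft (β.coord j)

theorem extCoeff_cons (j : I) (t : List I) (ω : ExteriorAlgebra F V) :
    extCoeff β (j :: t) ω = extCoeff β t (CliffordAlgebra.contractLeft (β.coord j) ω) := rfl

theorem extCoeff_ι_mul (t : List I) (x : V) (ω : ExteriorAlgebra F V) :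
    extCoeff β t (ι F x * ω) = listWedge (fun j => β.coord j x) t fun u => extCoeff β u ω := by
  induction t generalizing ω with
  | nil => simp [extCoeff, listWedge, ExteriorAlgebra.algebraMapInv]
  | cons j t ih =>
    rw [extCoeff_cons]
    erw [CliffordAlgebra.contractLeft_ι_mul]
    rw [map_sub, map_smul, listWedge, smul_eq_mul]
    erw [ih]
    rfl

theorem extCoeff_nil_one : extCoeff β [] 1 = 1 := by
  simp [extCoeff]

theorem extCoeff_cons_one (j : I) (t : List I) : extCoeff β (j :: t) 1 = 0 := by
  rw [extCoeff_cons]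
  erw [CliffordAlgebra.contractLeft_one]
  simp

theorem extCoeff_perm {t t' : List I} (h : t.Perm t') (ω : ExteriorAlgebra F V) :
    extCoeff β t ω = 0 ↔ extCoeff β t' ω = 0 := by
  induction h generalizing ω with
  | nil => rfl
  | cons j _ ih => exact ih _
  | swap j k t =>
    rw [extCoeff_cons, extCoeff_cons, extCoeff_cons, extCoeff_cons]
    erw [CliffordAlgebra.contractLeft_comm]
    rw [map_neg, neg_eq_zero]
  | trans _ _ ih1 ih2 => exact (ih1 ω).trans (ih2 ω)

theorem nodup_of_extCoeff_ne_zero {t : List I} {ω : ExteriorAlgebra F V}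
    (h : extCoeff β t ω ≠ 0) : t.Nodup := by
  induction t generalizing ω with
  | nil => exact List.nodup_nil
  | cons j t ih =>
    refine List.nodup_cons.2 ⟨fun hj => h ?_, ih h⟩
    obtain ⟨t', ht'⟩ : ∃ t', t.Perm (j :: t') := by
      classical exact ⟨_, List.perm_cons_erase hj⟩
    rw [extCoeff_perm β (ht'.cons j), extCoeff_cons, extCoeff_cons]
    erw [CliffordAlgebra.contractLeft_contractLeft]
    exact map_zero _

theorem length_of_extCoeff_ne_zero {n : ℕ} {ω : ExteriorAlgebra F V} (hω : ω ∈ ⋀[F]^n V)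
    {t : List I} (h : extCoeff β t ω ≠ 0) : t.length = n := by
  induction n generalizing ω t with
  | zero =>
    rw [exteriorPower, pow_zero, Submodule.mem_one] at hω
    obtain ⟨x, rfl⟩ := hω
    cases t with
    | nil => rfl
    | cons j t =>
      rw [Algebra.algebraMap_eq_smul_one, map_smul, extCoeff_cons_one, smul_zero] at h
      exact absurd rfl h
  | succ n ih =>
    by_contra hlen
    apply h
    rw [exteriorPower, pow_succ'] at hω
    induction hω using Submodule.mul_induction_on' with
    | mem_mul_mem x hx y hy =>
      obtain ⟨v, rfl⟩ := hx
      by_contra h'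
      rw [extCoeff_ι_mul] at h'
      obtain ⟨k, t', hp, -, ht'⟩ := exists_of_listWedge_ne_zero h'
      exact hlen (by rw [hp.length_eq, List.length_cons, ih hy ht'])
    | add x _ y _ hx hy =>
      rw [map_add]
      by_cases h1 : extCoeff β t x = 0
      · rw [h1, zero_add]
        by_contra h2
        exact h2 (hy h2)
      · exact absurd (hx h1) h1

theorem extCoeff_finite_support (ω : ExteriorAlgebra F V) :
    ∃ T : Set I, T.Finite ∧ ∀ t, extCoeff β t ω ≠ 0 → ∀ j ∈ t, j ∈ T := by
  induction ω using CliffordAlgebra.left_induction with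
  | algebraMap r =>
    refine ⟨∅, Set.finite_empty, fun t ht j hj => ?_⟩
    cases t with
    | nil => simp at hj
    | cons j t =>
      erw [Algebra.algebraMap_eq_smul_one, map_smul, extCoeff_cons_one, smul_zero] at ht
      exact absurd rfl ht
  | add x y hx hy =>
    obtain ⟨T, hT, hx⟩ := hx
    obtain ⟨U, hU, hy⟩ := hy
    refine ⟨T ∪ U, hT.union hU, fun t ht j hj => ?_⟩
    by_cases h1 : extCoeff β t x = 0
    · erw [map_add, h1, zero_add] at ht
      exact Or.inr (hy t ht j hj)
    · exact Or.inl (hx t h1 j hj)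
  | ι_mul x v hx =>
    obtain ⟨T, hT, hx⟩ := hx
    refine ⟨T ∪ (β.repr v).support, hT.union (Finset.finite_toSet _), fun t ht j hj => ?_⟩
    erw [extCoeff_ι_mul] at ht
    obtain ⟨k, t', hp, hk, ht'⟩ := exists_of_listWedge_ne_zero ht
    rcases List.mem_cons.1 (hp.subset hj) with rfl | hj'
    · exact Or.inr (by simpa using hk)
    · exact Or.inl (hx t' ht' j hj')

/-- The product in the exterior algebra of the basis vectors with indices in a list. -/
noncomputable def basisProd (u : List I) : ExteriorAlgebra F V := (u.map fun j => ι F (β j)).prod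

theorem extCoeff_basisProd_mul {u t : List I} (h : (u ++ t).Nodup) (ω : ExteriorAlgebra F V) :
    extCoeff β (u ++ t) (basisProd β u * ω) = extCoeff β t ω := by
  induction u with
  | nil => simp [basisProd]
  | cons j u ih =>
    rw [List.cons_append, List.nodup_cons] at h
    rw [basisProd, List.map_cons, List.prod_cons, mul_assoc, extCoeff_ι_mul, List.cons_append,
      listWedge, listWedge_eq_zero, ← basisProd, ih h.2]
    · simp
    · rintro k hk
      have : k ≠ j := fun e => h.1 (e ▸ hk)
      simp [Finsupp.single_eq_of_ne this]

theorem exists_perm_of_extCoeff_basisProd_mul {u t : List I} {ω : ExteriorAlgebra F V}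
    (h : extCoeff β t (basisProd β u * ω) ≠ 0) :
    ∃ t', t.Perm (u ++ t') ∧ extCoeff β t' ω ≠ 0 := by
  induction u generalizing t with
  | nil => exact ⟨t, List.Perm.refl _, by simpa [basisProd] using h⟩
  | cons j u ih =>
    rw [basisProd, List.map_cons, List.prod_cons, mul_assoc, extCoeff_ι_mul, ← basisProd] at h
    obtain ⟨k, t', hp, hk, ht'⟩ := exists_of_listWedge_ne_zero h
    obtain ⟨t'', hp', ht''⟩ := ih ht'
    have hkj : k = j := by
      by_contra hne
      exact hk (by simp [Finsupp.single_eq_of_ne hne])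
    subst hkj
    exact ⟨t'', hp.trans (hp'.cons k), ht''⟩

theorem eq_zero_of_extCoeff_eq_zero [LinearOrder I] {ω : ExteriorAlgebra F V}
    (h : ∀ t : List I, extCoeff β t ω = 0) : ω = 0 := by
  classical
  have hb : ∀ s : Finset I, β.ExteriorAlgebra s = basisProd β s.sort := by
    intro s
    refine (ExteriorAlgebra.basis_apply_ofCard β (rfl : s.card = _)).trans
      ((ιMulti_apply _).trans ?_)
    rw [basisProd]
    congr 1
    apply List.ext_getElem
    · simp
    · intro i h1 h2
      simp [Set.powersetCard.ofFinEmbEquiv_symm_apply, Finset.orderEmbOfFin_apply]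
  rw [← β.ExteriorAlgebra.repr.map_eq_zero_iff]
  ext s
  have hs := h s.sort
  rw [← β.ExteriorAlgebra.linearCombination_repr ω, Finsupp.linearCombination_apply, Finsupp.sum,
    map_sum, Finset.sum_eq_single s] at hs
  · rw [map_smul, hb] at hs
    have h1 := extCoeff_basisProd_mul β (u := s.sort) (t := []) (by simp) 1
    rw [List.append_nil, mul_one, extCoeff_nil_one] at h1
    rwa [h1, smul_eq_mul, mul_one] at hs
  · intro s' _ hne
    rw [map_smul, hb]
    by_contra h'
    have h2 := right_ne_zero_of_smul h'
    rw [← mul_one (basisProd β _)] at h2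
    obtain ⟨t', hp, ht'⟩ := exists_perm_of_extCoeff_basisProd_mul β h2
    cases t' with
    | nil =>
      rw [List.append_nil] at hp
      apply hne
      ext x
      rw [← Finset.mem_sort (· ≤ ·), ← Finset.mem_sort (s := s) (· ≤ ·), hp.mem_iff]
    | cons j t' => exact ht' (extCoeff_cons_one β j t')
  · intro hs'
    rw [Finsupp.notMem_support_iff.1 hs', zero_smul, map_zero]

end ExtCoeff

section Rank

variable {I : Type*}

/-- The rank of a list of indices; it compares multisets of indices colexicographically. -/
noncomputable def listRank (t : List I) : Colex (I →₀ ℕ) :=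
  (t.map fun j => toColex (Finsupp.single j 1)).sum

theorem listRank_cons (j : I) (t : List I) :
    listRank (j :: t) = toColex (Finsupp.single j 1) + listRank t := by
  simp [listRank]

theorem List.Perm.listRank_eq {s t : List I} (h : s.Perm t) : listRank s = listRank t :=
  (h.map _).sum_eq

variable [LinearOrder I]

theorem ofColex_listRank (t : List I) (j : I) : ofColex (listRank t) j = t.count j := by
  induction t with
  | nil => rfl
  | cons k t ih =>
    have : ofColex (listRank (k :: t)) j = Finsupp.single k 1 j + ofColex (listRank t) j := by
      rw [listRank_cons]; rfl
    rw [this, ih, List.count_cons, add_comm, Finsupp.single_apply]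
    simp [beq_iff_eq]

theorem perm_of_listRank_eq {s t : List I} (h : listRank s = listRank t) : s.Perm t := by
  rw [List.perm_iff_count]
  intro j
  rw [← ofColex_listRank, ← ofColex_listRank, h]

theorem listRank_cons_le {j k : I} (hjk : j ≤ k) {s t : List I} (h : listRank s ≤ listRank t) :
    listRank (j :: s) ≤ listRank (k :: t) := by
  rw [listRank_cons, listRank_cons]
  exact add_le_add (Finsupp.Colex.single_le_iff.2 hjk) h

theorem listRank_cons_lt {j k : I} (hjk : j < k) (t : List I) :
    listRank (j :: t) < listRank (k :: t) := by
  rw [listRank_cons, listRank_cons]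
  exact add_lt_add_left (Finsupp.Colex.single_lt_iff.2 hjk) _

open Module

variable {F V : Type*} [Field F] [AddCommGroup V] [Module F V] (β : Basis I F V)

theorem extCoeff_prod_triangular {s : List I} (hs : s.Pairwise (· < ·)) (x : I → V)
    (hx : ∀ k ∈ s, ∀ j, k < j → β.coord j (x k) = 0) :
    extCoeff β s (s.map fun k => ι F (x k)).prod = (s.map fun k => β.coord k (x k)).prod := by
  induction s with
  | nil => exact extCoeff_nil_one β
  | cons k s ih =>
    rw [List.pairwise_cons] at hs
    rw [List.map_cons, List.prod_cons, extCoeff_ι_mul, listWedge, listWedge_eq_zero, sub_zero, ih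
      hs.2 fun k hk => hx k (by simp [hk])]
    · rfl
    · exact fun j hj => hx k (by simp) j (hs.1 j hj)

theorem listRank_le_of_extCoeff_prod_ne_zero {s : List I} (x : I → V)
    (hx : ∀ k ∈ s, ∀ j, k < j → β.coord j (x k) = 0) {t : List I}
    (h : extCoeff β t (s.map fun k => ι F (x k)).prod ≠ 0) : listRank t ≤ listRank s := by
  induction s generalizing t with
  | nil =>
    cases t with
    | nil => rfl
    | cons j t => exact absurd (extCoeff_cons_one β j t) h
  | cons k s ih =>
    rw [List.map_cons, List.prod_cons, extCoeff_ι_mul] at h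
    obtain ⟨j, t', hp, hj, ht'⟩ := exists_of_listWedge_ne_zero h
    rw [hp.listRank_eq]
    refine listRank_cons_le ?_ (ih (fun k hk => hx k (by simp [hk])) ht')
    by_contra hlt
    exact hj (hx k (by simp) j (not_le.1 hlt))

end Rank

section Leading

variable {F I : Type*} [Field F] [LinearOrder I] {p : ℕ} [hpr : Fact p.Prime] [CharP F p]
  {D : I → Derivation ℤ F F}

theorem exists_log_factors
    (hF : ∀ x : F, ∃ y : F, y ^ (p - 1) = x)
    {s : List I} (hs0 : s ≠ []) (hs : s.Pairwise (· < ·)) {a : F} (ha : a ≠ 0)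
    (h1 : ∀ u v, s = u ++ v → ∀ j, (∀ k ∈ u, k < j) → D j (projList p D v a) = 0)
    (h2 : projList p D s a = a ^ p) :
    ∃ c : I → F, a = (s.map c).prod ∧
      ∀ k ∈ s, c k ^ p = constProj p (D k) (c k) ∧ ∀ j, k < j → D j (c k) = 0 := by
  induction s using List.reverseRecOn generalizing a with
  | nil => exact absurd rfl hs0
  | append_singleton s k ih =>
    have hlt : ∀ i ∈ s, i < k := fun i hi => by
      rw [List.pairwise_append] at hs
      exact hs.2.2 i hi k (by simp)
    have hDa : ∀ j, k < j → D j a = 0 := fun j hj => h1 (s ++ [k]) [] (by simp) j fun i hi => by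
      rcases List.mem_append.1 hi with hi | hi
      · exact (hlt i hi).trans hj
      · exact (List.mem_singleton.1 hi) ▸ hj
    by_cases hs' : s = []
    · subst hs'
      exact ⟨fun _ => a, by simp, fun i hi => by
        obtain rfl : i = k := by simpa using hi
        exact ⟨h2.symm, hDa⟩⟩
    set a' := constProj p (D k) a with ha'
    have h2' : projList p D s a' = a ^ p := by rw [← h2, projList_append]; rfl
    have ha'0 : a' ≠ 0 := by
      intro h0
      rw [h0, map_zero] at h2'
      exact pow_ne_zero p ha h2'.symm
    have hDa' : ∀ j, (∀ i ∈ s, i < j) → D j a' = 0 := fun j hj => h1 s [k] rfl j hj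
    obtain ⟨g, hg⟩ := hF (a ^ p / a')
    have hp1 : p - 1 ≠ 0 := by have := hpr.out.two_le; omega
    have hg0 : g ≠ 0 := by
      rintro rfl
      rw [zero_pow hp1] at hg
      exact div_ne_zero (pow_ne_zero p ha) ha'0 hg.symm
    have hgp : g ^ p * a' = g * a ^ p := by
      have : g ^ p = g ^ (p - 1) * g := by
        rw [← pow_succ, Nat.sub_add_cancel hpr.out.one_le]
      rw [this, hg]
      field_simp
    have hga : g = (g / a) ^ p * a' := by
      rw [div_pow, div_mul_eq_mul_div, hgp, mul_div_assoc, div_self (pow_ne_zero p ha), mul_one]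
    have hDg : ∀ j, (∀ i ∈ s, i < j) → D j g = 0 := fun j hj => by
      rw [hga, Derivation.leibniz, hDa' j hj, Derivation.map_pow_char]
      simp
    have hDinv : ∀ j, (∀ i ∈ s, i < j) → D j g⁻¹ = 0 := fun j hj => by
      rw [Derivation.leibniz_inv, hDg j hj, smul_zero]
    obtain ⟨c, hc, hcs⟩ := ih hs' (List.pairwise_append.1 hs).1 hg0
      (fun u v huv j hj => by
        rw [hga, projList_pow_mul, Derivation.leibniz, Derivation.map_pow_char, smul_zero,
          add_zero]
        have := h1 u (v ++ [k]) (by rw [huv, List.append_assoc]) j hj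
        rw [projList_append] at this
        rw [show projList p D v a' = projList p D v (projList p D [k] a) from rfl, this,
          smul_zero])
      (by
        conv_lhs => rw [hga]
        rw [projList_pow_mul, h2', div_pow, div_mul_cancel₀ _ (pow_ne_zero p ha)])
    have hks : k ∉ s := fun h => lt_irrefl _ (hlt k h)
    refine ⟨Function.update c k (a / g), ?_, fun i hi => ?_⟩
    · rw [List.map_append, List.prod_append, List.map_singleton, List.prod_singleton,
        Function.update_self, List.map_congr_left (g := c), ← hc, mul_div_cancel₀ _ hg0]
      intro i hi
      exact Function.update_of_ne (fun h : i = k => hks (h ▸ hi)) _ _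
    · rcases List.mem_append.1 hi with hi | hi
      · rw [Function.update_of_ne fun h : i = k => hks (h ▸ hi)]
        exact hcs i hi
      · obtain rfl : i = k := by simpa using hi
        rw [Function.update_self]
        constructor
        · rw [div_eq_inv_mul a g, constProj_mul _ _ (hDinv i hlt), ← ha', ← div_eq_inv_mul,
            ← div_eq_inv_mul, div_pow, div_eq_div_iff (pow_ne_zero p hg0) hg0]
          linear_combination -hgp
        · intro j hj
          rw [div_eq_mul_inv, Derivation.leibniz, hDa j hj,
            hDinv j fun i' hi' => (hlt i' hi').trans hj]
          simp

theorem exists_logs (hcomm : ∀ i j x, D i (D j x) = D j (D i x))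
    (hD : ∀ i x, (D i)^[p] x = D i x) {b : I → F} (hb0 : ∀ i, b i ≠ 0)
    (hDb : ∀ i, D i (b i) = b i) (hDb' : ∀ i j, i ≠ j → D i (b j) = 0)
    (hF : ∀ x : F, ∃ y : F, y ^ (p - 1) = x)
    {s : List I} (hs0 : s ≠ []) (hs : s.Pairwise (· < ·)) {a : F} (ha : a ≠ 0)
    (h1 : ∀ u v, s = u ++ v → ∀ j, (∀ k ∈ u, k < j) → D j (projList p D v a) = 0)
    (h2 : projList p D s a = a ^ p) :
    ∃ y : I → F, a = (s.map fun k => (y k)⁻¹ * D k (y k)).prod ∧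
      ∀ k ∈ s, y k ≠ 0 ∧ ∀ j, k < j → D j (y k) = 0 := by
  obtain ⟨c, hc, hcs⟩ := exists_log_factors hF hs0 hs ha h1 h2
  have : ∀ k, ∃ y, k ∈ s → y ≠ 0 ∧ (∀ j, k < j → D j y = 0) ∧ D k y = c k * y := by
    intro k
    by_cases hk : k ∈ s
    · let W : Subfield F :=
        { carrier := {x | ∀ j, k < j → D j x = 0}
          mul_mem' := fun {x y} hx hy j hj => by rw [Derivation.leibniz, hx j hj, hy j hj]; simp
          one_mem' := fun j _ => Derivation.map_one_eq_zero _
          add_mem' := fun {x y} hx hy j hj => by rw [map_add, hx j hj, hy j hj, add_zero]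
          zero_mem' := fun j _ => map_zero _
          neg_mem' := fun {x} hx j hj => by rw [map_neg, hx j hj, neg_zero]
          inv_mem' := fun x hx j hj => by rw [Derivation.leibniz_inv, hx j hj, smul_zero] }
      obtain ⟨y, hyW, hy0, hy⟩ := exists_log_of_pow_eq_constProj (hD k) W
        (fun x hx j hj => by rw [hcomm, hx j hj, map_zero]) (b k)
        (fun j hj => hDb' j k hj.ne') (hb0 k) (hDb k) (c k) (hcs k hk).2 (hcs k hk).1
      exact ⟨y, fun _ => ⟨hy0, hyW, hy⟩⟩
    · exact ⟨0, fun h => absurd h hk⟩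
  choose y hy using this
  refine ⟨y, ?_, fun k hk => ⟨(hy k hk).1, (hy k hk).2.1⟩⟩
  rw [hc]
  congr 1
  refine List.map_congr_left fun k hk => ?_
  rw [(hy k hk).2.2, mul_comm (c k), inv_mul_cancel_left₀ (hy k hk).1]

theorem deriv_projList_leading (hcomm : ∀ i j x, D i (D j x) = D j (D i x))
    (hD : ∀ i x, (D i)^[p] x = D i x) {φ : List I → F} (h : ∀ t, listDeriv D t φ = 0)
    {s : List I} (hmax : ∀ t, φ t ≠ 0 → listRank t ≤ listRank s) (u v : List I) (hs : s = u ++ v)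
    (j : I) (hj : ∀ k ∈ u, k < j) : D j (projList p D v (φ s)) = 0 := by
  have h0 := h (j :: s)
  rw [listDeriv, sub_eq_zero] at h0
  rw [deriv_projList hcomm, h0]
  conv_lhs => rw [hs]
  refine projList_listDeriv_append hcomm hD u v _ fun k u' hu => ?_
  by_contra hne
  have hle := hmax _ hne
  have hperm : s.Perm (k :: (u' ++ v)) := by rw [hs]; exact hu.append_right v
  rw [hperm.listRank_eq] at hle
  exact absurd (listRank_cons_lt (hj k (hu.mem_iff.2 (by simp))) _) (not_lt.2 hle)

end Leading

section Induction

open Module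

theorem exists_maximal_extCoeff {F V I : Type*} [Field F] [AddCommGroup V] [Module F V]
    [LinearOrder I] (β : Basis I F V) {ω : ExteriorAlgebra F V} (hω : ω ≠ 0) :
    ∃ s : List I, s.Pairwise (· < ·) ∧ extCoeff β s ω ≠ 0 ∧
      ∀ t, extCoeff β t ω ≠ 0 → listRank t ≤ listRank s := by
  classical
  obtain ⟨T, hT, hTω⟩ := extCoeff_finite_support β ω
  have key : ∀ t, extCoeff β t ω ≠ 0 → t.toFinset.sort.Perm t ∧
      t.toFinset ∈ hT.toFinset.powerset.filter fun U => extCoeff β U.sort ω ≠ 0 := by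
    intro t ht
    have hp : t.toFinset.sort.Perm t :=
      (t.toFinset.sort_perm_toList (· ≤ ·)).trans
        (List.toFinset_toList (nodup_of_extCoeff_ne_zero β ht))
    refine ⟨hp, Finset.mem_filter.2 ⟨Finset.mem_powerset.2 fun j hj => ?_, ?_⟩⟩
    · simpa using hTω t ht j (List.mem_toFinset.1 hj)
    · rwa [Ne, extCoeff_perm β hp]
  obtain ⟨t₀, ht₀⟩ : ∃ t, extCoeff β t ω ≠ 0 := by
    by_contra! h
    exact hω (eq_zero_of_extCoeff_eq_zero β h)
  obtain ⟨U, hU, hmax⟩ := Finset.exists_max_image _ (fun U : Finset I => listRank (U.sort (· ≤ ·)))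
    ⟨_, (key t₀ ht₀).2⟩
  refine ⟨U.sort, Finset.sortedLT_sort U |>.pairwise, (Finset.mem_filter.1 hU).2, fun t ht => ?_⟩
  rw [← (key t ht).1.listRank_eq]
  exact hmax _ (key t ht).2

variable {F I : Type} [Field F] {p : ℕ} [hpr : Fact p.Prime] [CharP F p]
  {β : Basis I F (Ω[F⁄ℤ])} {D : I → Derivation ℤ F F}

variable (F) in
/-- The logarithmic form of a list of elements of a field. -/
noncomputable def logList (l : List F) : ExtOmega F :=
  (l.map fun x => ι F (x⁻¹ • KaehlerDifferential.D ℤ F x)).prod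

theorem logForm_eq_logList {n : ℕ} (x : Fin n → F) : logForm F x = logList F (List.ofFn x) := by
  rw [logForm, logList, List.map_ofFn]
  rfl

theorem logList_cons (x : F) (l : List F) :
    logList F (x :: l) = ι F (x⁻¹ • KaehlerDifferential.D ℤ F x) * logList F l := by
  simp [logList]

theorem logList_append (l l' : List F) : logList F (l ++ l') = logList F l * logList F l' := by
  simp [logList]

theorem coord_dlog (hβ : ∀ i x, β.coord i (KaehlerDifferential.D ℤ F x) = D i x) (i : I) (x : F) :
    β.coord i (x⁻¹ • KaehlerDifferential.D ℤ F x) = x⁻¹ * D i x := by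
  rw [map_smul, hβ, smul_eq_mul]

theorem extCoeff_logList_closed
    (hβ : ∀ i x, β.coord i (KaehlerDifferential.D ℤ F x) = D i x)
    (hcomm : ∀ i j x, D i (D j x) = D j (D i x)) (hD : ∀ i x, (D i)^[p] x = D i x)
    (l : List F) (hl : ∀ x ∈ l, x ≠ 0) :
    (∀ t, listDeriv D t (fun u => extCoeff β u (logList F l)) = 0) ∧
      ∀ t, projList p D t (extCoeff β t (logList F l)) = extCoeff β t (logList F l) ^ p := by
  induction l with
  | nil =>
    have h1 : ∀ t, t ≠ [] → extCoeff β t (logList F []) = 0 := fun t ht => by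
      cases t with
      | nil => exact absurd rfl ht
      | cons j t => exact extCoeff_cons_one β j t
    have h2 : extCoeff β [] (logList F []) = 1 := extCoeff_nil_one β
    constructor
    · intro t
      cases t with
      | nil => rfl
      | cons j t =>
        have h3 : D j (extCoeff β t (logList F [])) = 0 := by
          cases t with
          | nil => rw [h2, Derivation.map_one_eq_zero]
          | cons k t => rw [h1 _ (by simp), map_zero]
        have h4 : listDeriv D t (fun _ => (0 : F)) = 0 := by
          simpa using listDeriv_sub (D := D) t (fun _ => (0 : F)) fun _ => 0
        rw [listDeriv, h3, zero_sub, neg_eq_zero]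
        simp only [h1 _ (List.cons_ne_nil _ _), h4]
    · intro t
      cases t with
      | nil => rw [h2, projList_nil, one_pow]
      | cons j t => rw [h1 _ (by simp), map_zero, zero_pow hpr.out.ne_zero]
  | cons x l ih =>
    obtain ⟨ih1, ih2⟩ := ih fun y hy => hl y (by simp [hy])
    have hx : x ≠ 0 := hl x (by simp)
    have hc : ∀ j k, D j (x⁻¹ * D k x) = D k (x⁻¹ * D j x) := fun j k => by
      simp only [Derivation.leibniz, Derivation.leibniz_inv, smul_eq_mul, hcomm j k]
      ring
    have he : ∀ u, extCoeff β u (logList F (x :: l)) =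
        listWedge (fun j => x⁻¹ * D j x) u fun u => extCoeff β u (logList F l) := fun u => by
      rw [logList_cons, extCoeff_ι_mul]
      simp only [coord_dlog hβ]
    simp only [he]
    exact ⟨deriv_list_eq_zero_wedge hc ih1, projList_listWedge hcomm hD hc
      (fun j => pow_eq_constProj_of_log (hD j) x hx) ih1 ih2⟩

theorem le_of_leading_forms [LinearOrder I] [WellFoundedLT I]
    (hβ : ∀ i x, β.coord i (KaehlerDifferential.D ℤ F x) = D i x)
    (hcomm : ∀ i j x, D i (D j x) = D j (D i x)) (hD : ∀ i x, (D i)^[p] x = D i x)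
    {b : I → F} (hb0 : ∀ i, b i ≠ 0)
    (hDb : ∀ i, D i (b i) = b i) (hDb' : ∀ i j, i ≠ j → D i (b j) = 0)
    (hF : ∀ x : F, ∃ y : F, y ^ (p - 1) = x) {N G : AddSubgroup (ExtOmega F)} (hGN : G ≤ N)
    (hclosed : ∀ ω ∈ N, ∀ t, listDeriv D t (fun u => extCoeff β u ω) = 0)
    (hcart : ∀ ω ∈ N, ∀ t, projList p D t (extCoeff β t ω) = extCoeff β t ω ^ p)
    (hnil : ∀ ω ∈ N, extCoeff β [] ω = 0)
    (hlead : ∀ s : List I, s.Pairwise (· < ·) → (∃ ω ∈ N, extCoeff β s ω ≠ 0) → ∀ y : I → F,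
      (∀ k ∈ s, y k ≠ 0 ∧ ∀ j, k < j → D j (y k) = 0) → logList F (s.map y) ∈ G) :
    N ≤ G := by
  suffices h : ∀ (r : Colex (I →₀ ℕ)) (ω : ExtOmega F), ω ∈ N →
      (∀ t, extCoeff β t ω ≠ 0 → listRank t ≤ r) → ω ∈ G by
    intro ω hω
    by_cases h0 : ω = 0
    · rw [h0]; exact zero_mem _
    obtain ⟨s, -, hs0, hmax⟩ := exists_maximal_extCoeff β h0
    exact h _ ω hω hmax
  intro r
  induction r using WellFoundedLT.induction with
  | ind r ih =>
    intro ω hω hr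
    by_cases h0 : ω = 0
    · rw [h0]; exact zero_mem _
    obtain ⟨s, hs, hs0, hmax⟩ := exists_maximal_extCoeff β h0
    obtain ⟨y, hy, hys⟩ := exists_logs hcomm hD hb0 hDb hDb' hF (s := s)
      (fun h => hs0 (h ▸ hnil ω hω)) hs hs0
      (fun u v huv j hj => deriv_projList_leading hcomm hD (hclosed ω hω) hmax u v huv j hj)
      (hcart ω hω s)
    have hχ := hlead s hs ⟨ω, hω, hs0⟩ y hys
    have hχe : logList F (s.map y) =
        (s.map fun k => ι F ((y k)⁻¹ • KaehlerDifferential.D ℤ F (y k))).prod := by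
      rw [logList, List.map_map]
      rfl
    have htri : ∀ k ∈ s, ∀ j, k < j →
        β.coord j ((y k)⁻¹ • KaehlerDifferential.D ℤ F (y k)) = 0 := fun k hk j hj => by
      rw [coord_dlog hβ, (hys k hk).2 j hj, mul_zero]
    have hs1 : extCoeff β s (ω - logList F (s.map y)) = 0 := by
      rw [map_sub, hχe, extCoeff_prod_triangular β hs _ htri, hy, sub_eq_zero]
      simp only [coord_dlog hβ]
    rw [← sub_add_cancel ω (logList F (s.map y))]
    refine add_mem ?_ hχ
    by_cases h0' : ω - logList F (s.map y) = 0
    · rw [h0']; exact zero_mem _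
    obtain ⟨t, -, ht, hmax'⟩ := exists_maximal_extCoeff β h0'
    refine ih (listRank t) (lt_of_lt_of_le ?_ (hr s hs0)) _ (sub_mem hω (hGN hχ)) hmax'
    refine lt_of_le_of_ne ?_ fun heq => ht ((extCoeff_perm β (perm_of_listRank_eq heq) _).2 hs1)
    by_cases h1 : extCoeff β t ω = 0
    · rw [map_sub, h1, zero_sub, neg_ne_zero, hχe] at ht
      exact listRank_le_of_extCoeff_prod_ne_zero β _ htri ht
    · exact hmax t h1

end Induction

section KaehlerFields

open Module

variable {F : Type} [Field F] {p : ℕ} [hpr : Fact p.Prime] [CharP F p]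

theorem Derivation.ext_of_basis {I : Type} {b : I → F} {β : Basis I F (Ω[F⁄ℤ])}
    (hβ : ∀ i, β i = (b i)⁻¹ • KaehlerDifferential.D ℤ F (b i))
    {E : Derivation ℤ F F} (hE : ∀ i, E (b i) = 0) (x : F) : E x = 0 := by
  have h : E.liftKaehlerDifferential = 0 := β.ext fun i => by
    rw [hβ, LinearMap.map_smul, Derivation.liftKaehlerDifferential_comp_D, hE, smul_zero]
    rfl
  rw [← Derivation.liftKaehlerDifferential_comp_D E, h]
  rfl

/-- The derivation dual to the `i`-th vector of a basis of the space of differentials. -/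
noncomputable def coordDeriv {I : Type} (β : Basis I F (Ω[F⁄ℤ])) (i : I) : Derivation ℤ F F :=
  (β.coord i).compDer (KaehlerDifferential.D ℤ F)

theorem coord_D {I : Type} (β : Basis I F (Ω[F⁄ℤ])) (i : I) (x : F) :
    β.coord i (KaehlerDifferential.D ℤ F x) = coordDeriv β i x := rfl

section

variable {I : Type} {b : I → F} {β : Basis I F (Ω[F⁄ℤ])}

theorem D_eq_smul_basis (hb0 : ∀ i, b i ≠ 0)
    (hβ : ∀ i, β i = (b i)⁻¹ • KaehlerDifferential.D ℤ F (b i)) (i : I) : KaehlerDifferential.D ℤ F (b i) = b i • β i := by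
  rw [hβ, smul_smul, mul_inv_cancel₀ (hb0 i), one_smul]

theorem coordDeriv_self (hb0 : ∀ i, b i ≠ 0)
    (hβ : ∀ i, β i = (b i)⁻¹ • KaehlerDifferential.D ℤ F (b i)) (i : I) : coordDeriv β i (b i) = b i := by
  rw [← coord_D, D_eq_smul_basis hb0 hβ]
  simp

theorem coordDeriv_of_ne (hb0 : ∀ i, b i ≠ 0)
    (hβ : ∀ i, β i = (b i)⁻¹ • KaehlerDifferential.D ℤ F (b i)) (i j : I) (h : i ≠ j) : coordDeriv β i (b j) = 0 := by
  rw [← coord_D, D_eq_smul_basis hb0 hβ]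
  simp [Finsupp.single_eq_of_ne h]

theorem coordDeriv_comm (hb0 : ∀ i, b i ≠ 0)
    (hβ : ∀ i, β i = (b i)⁻¹ • KaehlerDifferential.D ℤ F (b i)) (i j : I) (x : F) :
    coordDeriv β i (coordDeriv β j x) = coordDeriv β j (coordDeriv β i x) := by
  rw [← sub_eq_zero, ← Derivation.commutator_apply]
  refine Derivation.ext_of_basis hβ (fun k => ?_) x
  rw [Derivation.commutator_apply]
  by_cases hi : i = k <;> by_cases hj : j = k
  · rw [hi, hj, sub_self]
  · rw [coordDeriv_of_ne hb0 hβ j k hj, hi, coordDeriv_self hb0 hβ,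
      coordDeriv_of_ne hb0 hβ j k hj, map_zero, sub_zero]
  · rw [coordDeriv_of_ne hb0 hβ i k hi, hj, coordDeriv_self hb0 hβ,
      coordDeriv_of_ne hb0 hβ i k hi, map_zero, sub_zero]
  · rw [coordDeriv_of_ne hb0 hβ j k hj, coordDeriv_of_ne hb0 hβ i k hi, map_zero, map_zero,
      sub_zero]

theorem coordDeriv_iterate (hb0 : ∀ i, b i ≠ 0)
    (hβ : ∀ i, β i = (b i)⁻¹ • KaehlerDifferential.D ℤ F (b i)) (i : I) (x : F) :
    (coordDeriv β i)^[p] x = coordDeriv β i x := by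
  let E : Derivation ℤ F F := Derivation.mk' ((coordDeriv β i : F →ₗ[ℤ] F) ^ p) fun x y => by
    simp only [Derivation.toLinearMap_pow_apply, Derivation.iterate_prime_mul, smul_eq_mul]
    ring
  have hE : ∀ x, E x = (coordDeriv β i)^[p] x := fun x =>
    Derivation.toLinearMap_pow_apply _ _ _
  have h := Derivation.ext_of_basis hβ (E := E - coordDeriv β i) (fun k => ?_) x
  · rw [Derivation.sub_apply, hE, sub_eq_zero] at h
    exact h
  · rw [Derivation.sub_apply, hE, sub_eq_zero]
    by_cases hi : i = k
    · rw [hi, coordDeriv_self hb0 hβ, Function.iterate_fixed (coordDeriv_self hb0 hβ k)]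
    · obtain ⟨q, hq⟩ := Nat.exists_eq_succ_of_ne_zero hpr.out.ne_zero
      rw [hq, Function.iterate_succ_apply, coordDeriv_of_ne hb0 hβ i k hi,
        Function.iterate_fixed (map_zero _)]

end

theorem natDegree_minpoly_of_pow_mem {K : Type*} [Field K] [Algebra K F] {y : F} {z : K}
    (hz : algebraMap K F z = y ^ p) (hy : y ∉ (algebraMap K F).range) :
    IsIntegral K y ∧ (minpoly K y).natDegree = p := by
  have hirr : Irreducible (Polynomial.X ^ p - Polynomial.C z : Polynomial K) := by
    refine X_pow_sub_C_irreducible_of_prime hpr.out fun w hw => hy ⟨w, ?_⟩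
    rw [← hw, map_pow] at hz
    exact frobenius_inj F p hz
  have hmonic := Polynomial.monic_X_pow_sub_C z hpr.out.ne_zero
  have h0 : Polynomial.aeval y (Polynomial.X ^ p - Polynomial.C z) = 0 := by
    simp [hz]
  refine ⟨⟨_, hmonic, h0⟩, ?_⟩
  rw [← minpoly.eq_of_irreducible_of_monic hirr h0 hmonic, Polynomial.natDegree_X_pow_sub_C]

theorem finrank_adjoin_of_pow_mem {K : Type*} [Field K] [Algebra K F] {y : F} {z : K}
    (hz : algebraMap K F z = y ^ p) (hy : y ∉ (algebraMap K F).range) :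
    finrank K (IntermediateField.adjoin K {y}) = p := by
  obtain ⟨h1, h2⟩ := natDegree_minpoly_of_pow_mem hz hy
  rw [IntermediateField.adjoin.finrank h1, h2]

theorem exists_maximal_subfield {K : Subfield F} {x : F} (hx : x ∉ K) :
    ∃ M : Subfield F, K ≤ M ∧ x ∉ M ∧ ∀ N : Subfield F, M ≤ N → x ∉ N → N = M := by
  obtain ⟨M, hKM, hM⟩ := zorn_le_nonempty₀ {N : Subfield F | x ∉ N} (fun c hc hch N hN => by
    refine ⟨sSup c, fun h => ?_, fun N hN => le_sSup hN⟩
    obtain ⟨N', hN', hxN'⟩ := (Subfield.mem_sSup_of_directedOn ⟨N, hN⟩ hch.directedOn).1 h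
    exact hc hN' hxN') K hx
  exact ⟨M, hKM, hM.prop, fun N hMN hN => le_antisymm (hM.le_of_ge hN hMN) hMN⟩

theorem exists_derivation {K : Subfield F} (hK : ∀ x : F, x ^ p ∈ K) {x : F} (hx : x ∉ K) :
    ∃ δ : Derivation ℤ F F, (∀ y ∈ K, δ y = 0) ∧ δ x ≠ 0 := by
  obtain ⟨M, hKM, hxM, hM⟩ := exists_maximal_subfield hx
  have hrange : ∀ y, y ∉ M → y ∉ (algebraMap M F).range := fun y hy ⟨w, hw⟩ => hy (hw ▸ w.2)
  have hpow : ∀ y, algebraMap M F ⟨y ^ p, hKM (hK y)⟩ = y ^ p := fun y => rfl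
  have hxI := (natDegree_minpoly_of_pow_mem (hpow x) (hrange x hxM)).1
  have htop : IntermediateField.adjoin M {x} = ⊤ := by
    rw [eq_top_iff]
    intro y _
    by_cases hy : y ∈ M
    · exact IntermediateField.algebraMap_mem _ (⟨y, hy⟩ : M)
    have hxy : x ∈ IntermediateField.adjoin M {y} := by
      by_contra h
      have := hM (IntermediateField.adjoin M {y}).toSubfield
        (fun z hz => IntermediateField.algebraMap_mem _ (⟨z, hz⟩ : M)) h
      exact hy (this ▸ IntermediateField.mem_adjoin_simple_self M y)
    have hyI := (natDegree_minpoly_of_pow_mem (hpow y) (hrange y hy)).1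
    have : FiniteDimensional M (IntermediateField.adjoin M {y}) :=
      IntermediateField.adjoin.finiteDimensional hyI
    have heq : IntermediateField.adjoin M {x} = IntermediateField.adjoin M {y} :=
      IntermediateField.eq_of_le_of_finrank_eq
        (IntermediateField.adjoin_simple_le_iff.2 hxy)
        (by rw [finrank_adjoin_of_pow_mem (hpow x) (hrange x hxM),
          finrank_adjoin_of_pow_mem (hpow y) (hrange y hy)])
    rw [heq]
    exact IntermediateField.mem_adjoin_simple_self M y
  have hfin : Module.Finite M F := by
    have := IntermediateField.adjoin.finiteDimensional hxI
    rw [htop] at this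
    exact Module.Finite.equiv (IntermediateField.topEquiv (F := M) (E := F)).toLinearEquiv
  have hdx : KaehlerDifferential.D M F x ≠ 0 := by
    intro h0
    have hD : ∀ y, KaehlerDifferential.D M F y = 0 := by
      intro y
      have hy : y ∈ IntermediateField.adjoin M {x} := htop ▸ IntermediateField.mem_top
      induction hy using IntermediateField.adjoin_induction with
      | mem z hz => rw [Set.mem_singleton_iff.1 hz, h0]
      | algebraMap z => exact Derivation.map_algebraMap _ _
      | add y z _ _ hy hz => rw [map_add, hy, hz, add_zero]
      | inv y _ hy => rw [Derivation.leibniz_inv, hy, smul_zero]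
      | mul y z _ _ hy hz => rw [Derivation.leibniz, hy, hz, smul_zero, smul_zero, add_zero]
    have : Subsingleton (Ω[F⁄M]) := by
      rw [← Submodule.subsingleton_iff F, ← subsingleton_iff_bot_eq_top,
        ← KaehlerDifferential.span_range_derivation, eq_comm, Submodule.span_eq_bot]
      rintro _ ⟨y, rfl⟩
      exact hD y
    have : Algebra.FormallyUnramified M F := ⟨this⟩
    have : IsPurelyInseparable M F := (isPurelyInseparable_iff_pow_mem M p).2 fun y =>
      ⟨1, ⟨⟨y ^ p, hKM (hK y)⟩, by rw [pow_one]; rfl⟩⟩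
    have := Algebra.FormallyUnramified.range_eq_top_of_isPurelyInseparable M F
    exact hrange x hxM (this ▸ trivial)
  obtain ⟨f, hf⟩ : ∃ f : Module.Dual F (Ω[F⁄M]), f (KaehlerDifferential.D M F x) ≠ 0 := by
    by_contra! h
    exact hdx ((Module.forall_dual_apply_eq_zero_iff F _).1 h)
  refine ⟨(f.compDer (KaehlerDifferential.D M F)).restrictScalars ℤ, fun y hy => ?_, hf⟩
  have : KaehlerDifferential.D M F y = 0 :=
    Derivation.map_algebraMap (KaehlerDifferential.D M F) (⟨y, hKM hy⟩ : M)
  change f (KaehlerDifferential.D M F y) = 0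
  rw [this, map_zero]

theorem pow_mem_pClosure {F : Type} [Field F] {p : ℕ} (C : Set F) (x : F) : x ^ p ∈ pClosure F p C :=
  Subfield.subset_closure (Or.inl ⟨x, by simp⟩)

theorem mem_pClosure_iff (C : Set F) (x : F) :
    x ∈ pClosure F p C ↔ KaehlerDifferential.D ℤ F x ∈
      Submodule.span F (KaehlerDifferential.D ℤ F '' C) := by
  constructor
  · intro hx
    refine Subfield.closure_induction ?_ ?_ ?_ ?_ ?_ ?_ hx
    · rintro y (⟨z, rfl⟩ | hy)
      · have : KaehlerDifferential.D ℤ F (z ^ p ^ 1) = 0 := by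
          rw [pow_one, Derivation.leibniz_pow, ← Nat.cast_smul_eq_nsmul F, CharP.cast_eq_zero,
            zero_smul]
        rw [this]
        exact zero_mem _
      · exact Submodule.subset_span ⟨y, hy, rfl⟩
    · rw [Derivation.map_one_eq_zero]; exact zero_mem _
    · intro y z _ _ hy hz
      rw [map_add]; exact add_mem hy hz
    · intro y _ hy
      rw [map_neg]; exact neg_mem hy
    · intro y _ hy
      rw [Derivation.leibniz_inv]; exact Submodule.smul_mem _ _ hy
    · intro y z _ _ hy hz
      rw [Derivation.leibniz]
      exact add_mem (Submodule.smul_mem _ _ hz) (Submodule.smul_mem _ _ hy)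
  · intro hx
    by_contra hn
    obtain ⟨δ, hδ, hδx⟩ := exists_derivation (pow_mem_pClosure C) hn
    apply hδx
    rw [← Derivation.liftKaehlerDifferential_comp_D δ]
    have hle : Submodule.span F (KaehlerDifferential.D ℤ F '' C) ≤
        LinearMap.ker δ.liftKaehlerDifferential := by
      rw [Submodule.span_le]
      rintro _ ⟨y, hy, rfl⟩
      change δ.liftKaehlerDifferential _ = 0
      rw [Derivation.liftKaehlerDifferential_comp_D]
      exact hδ y (Subfield.subset_closure (Or.inr hy))
    exact hle hx

end KaehlerFields

section Degrees

open Module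

variable {F : Type} [Field F] {p : ℕ} [hpr : Fact p.Prime] [CharP F p]

theorem mem_adjoin_iff_mem_pClosure {F : Type} [Field F] {p : ℕ} (A : Set F) (x : F) :
    x ∈ IntermediateField.adjoin (pClosure F p ∅) A ↔ x ∈ pClosure F p A := by
  constructor
  · intro hx
    induction hx using IntermediateField.adjoin_induction with
    | mem y hy => exact Subfield.subset_closure (Or.inr hy)
    | algebraMap y =>
      exact Subfield.closure_mono (Set.union_subset_union_right _ (Set.empty_subset A)) y.2
    | add y z _ _ hy hz => exact add_mem hy hz
    | inv y _ hy => exact inv_mem hy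
    | mul y z _ _ hy hz => exact mul_mem hy hz
  · intro hx
    have hle : pClosure F p A ≤ (IntermediateField.adjoin (pClosure F p ∅) A).toSubfield := by
      refine Subfield.closure_le.2 ?_
      rintro y (⟨z, rfl⟩ | hy)
      · have hz : z ^ p ^ 1 ∈ pClosure F p ∅ := Subfield.subset_closure (Or.inl ⟨z, rfl⟩)
        exact IntermediateField.algebraMap_mem _ (⟨z ^ p ^ 1, hz⟩ : pClosure F p ∅)
      · exact IntermediateField.subset_adjoin _ _ hy
    exact hle hx

theorem relDeg_of_linearIndepOn (A : Finset F)
    (hA : LinearIndepOn F (KaehlerDifferential.D ℤ F) (A : Set F)) :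
    relDeg F (pClosure F p ∅) (A : Set F) = p ^ A.card := by
  classical
  induction A using Finset.induction with
  | empty =>
    rw [relDeg, Finset.coe_empty, IntermediateField.adjoin_empty, Finset.card_empty, pow_zero]
    exact IntermediateField.finrank_bot
  | insert y A hyA ih =>
    rw [Finset.coe_insert] at hA ⊢
    have hA' := hA.mono (Set.subset_insert y (A : Set F))
    have hy : y ∉ IntermediateField.adjoin (pClosure F p ∅) (A : Set F) := by
      rw [mem_adjoin_iff_mem_pClosure, mem_pClosure_iff]
      exact (linearIndepOn_insert (by simpa using hyA)).1 hA |>.2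
    have hyp : y ^ p ∈ IntermediateField.adjoin (pClosure F p ∅) (A : Set F) := by
      rw [mem_adjoin_iff_mem_pClosure]
      exact pow_mem_pClosure _ y
    have h1 : finrank (IntermediateField.adjoin (pClosure F p ∅) (A : Set F))
        (IntermediateField.adjoin (IntermediateField.adjoin (pClosure F p ∅) (A : Set F)) {y})
        = p :=
      finrank_adjoin_of_pow_mem (z := ⟨y ^ p, hyp⟩) rfl fun ⟨w, hw⟩ => hy (hw ▸ w.2)
    have h2 := finrank_mul_finrank (pClosure F p ∅)
      (IntermediateField.adjoin (pClosure F p ∅) (A : Set F))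
      (IntermediateField.adjoin (IntermediateField.adjoin (pClosure F p ∅) (A : Set F)) {y})
    rw [h1, show finrank (pClosure F p ∅) (IntermediateField.adjoin (pClosure F p ∅) (A : Set F))
      = _ from ih hA'] at h2
    rw [relDeg, Set.insert_eq, Set.union_comm, ← IntermediateField.adjoin_adjoin_left,
      Finset.card_insert_of_notMem hyA, pow_succ]
    exact h2.symm

theorem card_le_of_pDegEq {A : Set F} {m k : ℕ} (hA : pDegEq F p A m) {s : Fin k → F}
    (hs : ∀ i, s i ∈ A) (hind : LinearIndependent F fun i => KaehlerDifferential.D ℤ F (s i)) :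
    k ≤ m := by
  classical
  have hinj : Function.Injective s := fun i j h =>
    hind.injective (by simp only [h])
  have h1 : LinearIndepOn F (KaehlerDifferential.D ℤ F)
      ((Finset.univ.image s : Finset F) : Set F) := by
    rw [Finset.coe_image, Finset.coe_univ, Set.image_univ]
    exact (linearIndepOn_range_iff hinj _).2 hind
  have h2 := relDeg_of_linearIndepOn (p := p) _ h1
  rw [Finset.card_image_of_injective _ hinj, Finset.card_univ, Fintype.card_fin] at h2
  have hle : IntermediateField.adjoin (pClosure F p ∅)
      ((Finset.univ.image s : Finset F) : Set F) ≤ IntermediateField.adjoin (pClosure F p ∅) A := by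
    refine IntermediateField.adjoin.mono _ _ _ ?_
    rw [Finset.coe_image]
    rintro _ ⟨i, _, rfl⟩
    exact hs i
  have hfin : Module.Finite (pClosure F p ∅) (IntermediateField.adjoin (pClosure F p ∅) A) :=
    Module.finite_of_finrank_pos (by
      rw [show finrank _ _ = p ^ m from hA]; exact pow_pos hpr.out.pos m)
  have h3 := LinearMap.finrank_le_finrank_of_injective
    (f := (IntermediateField.inclusion hle).toLinearMap)
    (IntermediateField.inclusion_injective hle)
  rw [show finrank _ _ = p ^ k from h2, show finrank _ _ = p ^ m from hA] at h3
  exact (Nat.pow_le_pow_iff_right hpr.out.one_lt).1 h3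

theorem linearIndependent_of_pIndep {k : ℕ} {c : Fin k → F} (hc : pIndep F p c) :
    LinearIndependent F fun i => KaehlerDifferential.D ℤ F (c i) := by
  classical
  obtain ⟨t, htc, -, hspan, ht⟩ := exists_linearIndepOn_extension
    (linearIndepOn_empty F (KaehlerDifferential.D ℤ F)) (Set.empty_subset (Set.range c))
  have htf : t.Finite := (Set.finite_range c).subset htc
  have heq : IntermediateField.adjoin (pClosure F p ∅) (Set.range c) =
      IntermediateField.adjoin (pClosure F p ∅) t := by
    ext x
    rw [mem_adjoin_iff_mem_pClosure, mem_adjoin_iff_mem_pClosure, mem_pClosure_iff,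
      mem_pClosure_iff, le_antisymm (Submodule.span_le.2 hspan)
      (Submodule.span_mono (Set.image_mono htc))]
  have hcard : t.ncard = k := by
    have h := relDeg_of_linearIndepOn (p := p) htf.toFinset (by simpa using ht)
    rw [htf.coe_toFinset, relDeg, ← heq, show finrank _ _ = p ^ k from hc] at h
    rw [Set.ncard_eq_toFinset_card t htf]
    exact (Nat.pow_right_injective hpr.out.two_le h).symm
  have hle : (Set.range c).ncard ≤ k := by
    rw [← Set.image_univ]
    refine (Set.ncard_image_le).trans ?_
    simp
  have htc' : t = Set.range c :=
    Set.eq_of_subset_of_ncard_le htc (hle.trans hcard.ge) (Set.finite_range c)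
  have hinj : Function.Injective c := by
    rw [← Set.injOn_univ]
    refine (Set.ncard_image_iff (Set.finite_univ)).1 ?_
    rw [Set.image_univ, ← htc', hcard]
    simp
  exact (linearIndepOn_range_iff hinj _).1 (htc' ▸ ht)

end Degrees

section OrderedBasis

open Module

variable {F : Type} [Field F]

theorem exists_ordered_basis {k : ℕ} {c : Fin k → F}
    (hc : LinearIndependent F fun i => KaehlerDifferential.D ℤ F (c i)) :
    ∃ (I : Type) (_ : LinearOrder I) (_ : WellFoundedLT I) (b : I → F)
      (β : Basis I F (Ω[F⁄ℤ])) (f : Fin k → I),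
      (∀ i, b i ≠ 0) ∧ (∀ i, β i = (b i)⁻¹ • KaehlerDifferential.D ℤ F (b i)) ∧
      StrictMono f ∧ (∀ i, b (f i) = c i) ∧ ∀ j ∉ Set.range f, ∀ i, f i < j := by
  classical
  have hinj : Function.Injective c := fun i j h => hc.injective (by simp only [h])
  obtain ⟨T, -, hcT, hspan, hT⟩ := exists_linearIndepOn_extension
    ((linearIndepOn_range_iff hinj _).2 hc) (Set.subset_univ (Set.range c))
  let J : Type := (T \ Set.range c : Set F)
  obtain ⟨_, _⟩ := exists_wellFoundedLT (α := J)
  let b : Fin k ⊕ₗ J → F := fun i => Sum.elim c Subtype.val (ofLex i)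
  have hbr : Set.range b = T := by
    have : Set.range b = Set.range (Sum.elim c (Subtype.val : J → F)) :=
      (ofLex : Fin k ⊕ₗ J ≃ _).surjective.range_comp _
    rw [this, Set.Sum.elim_range, Subtype.range_coe, Set.union_sdiff_cancel hcT]
  have hbinj : Function.Injective b := by
    refine Function.Injective.comp (g := Sum.elim c (Subtype.val : J → F)) ?_ ofLex.injective
    exact hinj.sumElim Subtype.val_injective fun i j h => j.2.2 ⟨i, h⟩
  have hbi : LinearIndependent F fun i => KaehlerDifferential.D ℤ F (b i) :=
    (linearIndepOn_range_iff hbinj _).1 (hbr ▸ hT)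
  have hb0 : ∀ i, b i ≠ 0 := fun i h => hbi.ne_zero i (by simp [h])
  let γ : Basis (Fin k ⊕ₗ J) F (Ω[F⁄ℤ]) := Basis.mk hbi (by
    rw [← KaehlerDifferential.span_range_derivation, Submodule.span_le, ← Set.image_univ]
    refine hspan.trans ?_
    rw [← hbr, ← Set.range_comp]
    rfl)
  refine ⟨Fin k ⊕ₗ J, inferInstance, ⟨Sum.lex_wf wellFounded_lt wellFounded_lt⟩, b,
    γ.unitsSMul fun i => (Units.mk0 (b i) (hb0 i))⁻¹, fun i => toLex (Sum.inl i), hb0, ?_, ?_,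
    fun i => rfl, ?_⟩
  · intro i
    rw [Basis.unitsSMul_apply, Basis.mk_apply]
    rfl
  · intro i j h
    exact Sum.Lex.inl_lt_inl_iff.2 h
  · intro j hj i
    cases hj' : ofLex j with
    | inl i' => exact absurd ⟨i', congrArg toLex hj'.symm⟩ hj
    | inr j' =>
      have : j = toLex (Sum.inr j') := congrArg toLex hj'
      rw [this]
      exact Sum.Lex.inl_lt_inr _ _

end OrderedBasis

section Closure

open Module

variable {F : Type} [Field F] {p : ℕ} [hpr : Fact p.Prime] [CharP F p]

/-- An element killed by all coordinate derivations outside `T` lies in `F^p(b i, i ∈ T)`. -/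
theorem mem_pClosure_of_coordDeriv {I : Type} {b : I → F} {β : Basis I F (Ω[F⁄ℤ])}
    (hβ : ∀ i, β i = (b i)⁻¹ • KaehlerDifferential.D ℤ F (b i)) {T : Set I} {y : F}
    (hy : ∀ j ∉ T, coordDeriv β j y = 0) : y ∈ pClosure F p (b '' T) := by
  rw [mem_pClosure_iff]
  have h : KaehlerDifferential.D ℤ F y ∈ Submodule.span F (β '' T) := by
    rw [Basis.mem_span_image]
    intro j hj
    by_contra h
    exact (Finsupp.mem_support_iff.1 hj) (hy j h)
  refine Submodule.span_le.2 ?_ h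
  rintro _ ⟨i, hi, rfl⟩
  rw [hβ]
  exact Submodule.smul_mem _ _ (Submodule.subset_span ⟨b i, ⟨i, hi, rfl⟩, rfl⟩)

theorem pClosure_mono {F : Type} [Field F] {p : ℕ} {A B : Set F} (h : A ⊆ B) : pClosure F p A ≤ pClosure F p B :=
  Subfield.closure_mono (Set.union_subset_union_right _ h)

end Closure

section Wedge

variable {K V : Type*} [Field K] [AddCommGroup V] [Module K V]

theorem ι_mul_eq_of_mem {n : ℕ} {ω : ExteriorAlgebra K V} (hω : ω ∈ ⋀[K]^n V) (x : V) :
    ι K x * ω = (-1) ^ n * (ω * ι K x) := by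
  induction hω using Submodule.pow_induction_on_left' with
  | algebraMap r => rw [pow_zero, one_mul, Algebra.commutes]
  | add y z i _ _ hy hz => rw [mul_add, hy, hz, add_mul, mul_add]
  | mem_mul m hm i y _ hy =>
    obtain ⟨v, rfl⟩ := hm
    have h1 : ι K x * ι K v = -(ι K v * ι K x) := eq_neg_of_add_eq_zero_left (ι_add_mul_swap x v)
    have h2 : ι K v * (-1) ^ i = (-1) ^ i * ι K v :=
      ((Commute.neg_one_left (ι K v)).pow_left i).eq.symm
    rw [← mul_assoc, h1, neg_mul, mul_assoc, hy, ← mul_assoc (ι K v), h2, pow_succ]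
    simp only [mul_assoc, mul_neg, neg_mul, one_mul]

theorem prod_ι_mul_eq_of_mem {n : ℕ} {ω : ExteriorAlgebra K V} (hω : ω ∈ ⋀[K]^n V) (l : List V) :
    (l.map (ι K)).prod * ω = (-1) ^ (n * l.length) * (ω * (l.map (ι K)).prod) := by
  induction l with
  | nil => simp
  | cons x l ih =>
    have h := ((Commute.neg_one_left (ι K x)).pow_left (n * l.length)).eq
    rw [List.map_cons, List.prod_cons, mul_assoc, ih, ← mul_assoc (ι K x), ← h, List.length_cons,
      mul_assoc, ← mul_assoc (ι K x), ι_mul_eq_of_mem hω, Nat.mul_succ, pow_add]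
    simp only [mul_assoc]

theorem prod_ι_mul_eq_zero_iff {n : ℕ} {ω : ExteriorAlgebra K V} (hω : ω ∈ ⋀[K]^n V)
    (l : List V) : (l.map (ι K)).prod * ω = 0 ↔ ω * (l.map (ι K)).prod = 0 := by
  rw [prod_ι_mul_eq_of_mem hω]
  exact ((isUnit_one.neg).pow _).mul_right_eq_zero

theorem prod_ofFn_ι_smul {k : ℕ} (u : Fin k → K) (v : Fin k → V) :
    (List.ofFn fun i => ι K (u i • v i)).prod = (∏ i, u i) • (List.ofFn fun i => ι K (v i)).prod := by
  rw [← ιMulti_apply, ← ιMulti_apply]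
  exact (ιMulti K k).map_smul_univ u v

theorem linearIndependent_of_prod_ι_ne_zero {k : ℕ} {v : Fin k → V}
    (h : (List.ofFn fun i => ι K (v i)).prod ≠ 0) : LinearIndependent K v := by
  by_contra hn
  rw [← ιMulti_apply] at h
  exact h ((ιMulti K k).map_linearDependent v hn)

/-- More than `k` vectors in the span of `k` vectors have trivial wedge product. -/
theorem prod_ι_eq_zero {k : ℕ} (w : Fin k → V) (l : List V)
    (hl : ∀ x ∈ l, x ∈ Submodule.span K (Set.range w)) (hk : k < l.length) :
    (l.map (ι K)).prod = 0 := by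
  classical
  by_contra h
  rw [← List.ofFn_get l, List.map_ofFn] at h
  have h1 := linearIndependent_of_prod_ι_ne_zero h
  have h2 := linearIndependent_le_span' l.get h1 (Set.range w) (by
    rintro _ ⟨i, rfl⟩
    exact hl _ (List.get_mem _ _))
  have h3 : Fintype.card (Set.range w) ≤ k := by
    simpa using Fintype.card_range_le w
  rw [Cardinal.mk_fin, Nat.cast_le] at h2
  omega

theorem prod_ι_mem (l : List V) : (l.map (ι K)).prod ∈ ⋀[K]^l.length V := by
  induction l with
  | nil => exact Submodule.one_le.1 (pow_zero (LinearMap.range (ι K : V →ₗ[K] _))).ge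
  | cons x l ih =>
    rw [List.map_cons, List.prod_cons, List.length_cons, exteriorPower, pow_succ']
    exact Submodule.mul_mem_mul ⟨x, rfl⟩ ih

end Wedge

section Nu

variable {F : Type} [Field F]

theorem logList_eq_prod (l : List F) : logList F l =
    ((l.map fun x => x⁻¹ • KaehlerDifferential.D ℤ F x).map (ι F)).prod := by
  rw [logList, List.map_map]
  rfl

theorem mem_nuPow_natCast {n : ℕ} {ω : ExtOmega F} : ω ∈ nuPow F n ↔
    ω ∈ AddSubgroup.closure {ω | ∃ l : List F, l.length = n ∧ (∀ x ∈ l, x ≠ 0) ∧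
      ω = logList F l} := by
  rw [nuPow, if_pos (Int.natCast_nonneg n)]
  have : {ω | ∃ x : Fin (n : ℤ).toNat → F, (∀ i, x i ≠ 0) ∧ ω = logForm F x} =
      {ω | ∃ l : List F, l.length = n ∧ (∀ x ∈ l, x ≠ 0) ∧ ω = logList F l} := by
    ext ω
    constructor
    · rintro ⟨x, hx, rfl⟩
      exact ⟨List.ofFn x, by simp, by simpa [List.mem_ofFn] using hx, logForm_eq_logList x⟩
    · rintro ⟨l, rfl, hl, rfl⟩
      refine ⟨l.get, fun i => hl _ (List.get_mem _ _), ?_⟩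
      rw [logForm_eq_logList]
      exact congrArg _ (List.ofFn_get l).symm
  rw [this]

theorem logList_mem_nuPow {n : ℕ} {l : List F} (hn : l.length = n) (hl : ∀ x ∈ l, x ≠ 0) :
    logList F l ∈ nuPow F n :=
  mem_nuPow_natCast.2 (AddSubgroup.subset_closure ⟨l, hn, hl, rfl⟩)

theorem nuPow_le {n : ℕ} {N : AddSubgroup (ExtOmega F)}
    (h : ∀ l : List F, l.length = n → (∀ x ∈ l, x ≠ 0) → logList F l ∈ N) : nuPow F n ≤ N := by
  intro ω hω
  refine (AddSubgroup.closure_le N).2 ?_ (mem_nuPow_natCast.1 hω)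
  rintro _ ⟨l, hn, hl, rfl⟩
  exact h l hn hl

theorem nuPow_le_exteriorPower (n : ℕ) :
    nuPow F n ≤ (⋀[F]^n (Ω[F⁄ℤ])).toAddSubgroup :=
  nuPow_le fun l hn _ => by
    rw [logList_eq_prod, ← hn, ← List.length_map (fun x => x⁻¹ • KaehlerDifferential.D ℤ F x)]
    exact prod_ι_mem _

theorem mem_annNu {n : ℕ} {U : Set (ExtOmega F)} {ω : ExtOmega F} :
    ω ∈ annNu F n U ↔ ω ∈ nuPow F n ∧ ∀ u ∈ U, ω * u = 0 := by
  have h := @nuPow_le_exteriorPower F _ n ω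
  simp only [annNu, annOmega, OmegaPow, if_pos (Int.natCast_nonneg n), Int.toNat_natCast,
    AddSubgroup.mem_inf, Submodule.mem_toAddSubgroup, Submodule.mem_inf, Submodule.mem_iInf,
    LinearMap.mem_ker, LinearMap.mulRight_apply] at h ⊢
  tauto

theorem logWedgeNu_le {K : Set F} {t : ℕ} {m : ℤ} {N : AddSubgroup (ExtOmega F)}
    (h : ∀ k : ℕ, m = k → ∀ l : List F, l.length = t → (∀ x ∈ l, x ∈ K ∧ x ≠ 0) →
      ∀ χ ∈ nuPow F k, logList F l * χ ∈ N) : logWedgeNu F K t m ≤ N := by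
  rw [logWedgeNu, AddSubgroup.closure_le]
  rintro _ ⟨y, hy, χ, hχ, rfl⟩
  by_cases hm : 0 ≤ m
  · obtain ⟨k, rfl⟩ := Int.eq_ofNat_of_zero_le hm
    rw [logForm_eq_logList]
    exact h k rfl _ (by simp) (by simpa [List.mem_ofFn] using hy) χ hχ
  · rw [nuPow, if_neg hm, AddSubgroup.mem_bot] at hχ
    rw [hχ, mul_zero]
    exact zero_mem _

theorem logList_append_mem_logWedgeNu {K : Set F} {t k : ℕ} {l l' : List F} (ht : l.length = t)
    (hk : l'.length = k) (hl : ∀ x ∈ l, x ∈ K ∧ x ≠ 0) (hl' : ∀ x ∈ l', x ≠ 0) :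
    logList F (l ++ l') ∈ logWedgeNu F K t k := by
  subst ht
  refine AddSubgroup.subset_closure
    ⟨l.get, fun i => hl _ (List.get_mem _ _), logList F l', logList_mem_nuPow hk hl', ?_⟩
  rw [logList_append, logForm_eq_logList]
  exact congrArg (logList F · * logList F l') (List.ofFn_get l).symm

theorem logList_mul_mem_nuPow {t k : ℕ} {l : List F} (ht : l.length = t) (hl : ∀ x ∈ l, x ≠ 0)
    {χ : ExtOmega F} (hχ : χ ∈ nuPow F k) : logList F l * χ ∈ nuPow F (t + k : ℕ) := by
  refine nuPow_le (N := (nuPow F (t + k : ℕ)).comap (AddMonoidHom.mulLeft (logList F l)))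
    (fun l' hk hl' => ?_) hχ
  change logList F l * logList F l' ∈ nuPow F ((t + k : ℕ) : ℤ)
  rw [← logList_append]
  refine logList_mem_nuPow (by simp [ht, hk]) fun x hx => ?_
  rcases List.mem_append.1 hx with hx | hx
  exacts [hl x hx, hl' x hx]

/-- A group of forms `dy₁/y₁ ∧ … ∧ dy_t/y_t ∧ χ` annihilates `U` as soon as the wedge products
`dy₁/y₁ ∧ … ∧ dy_t/y_t` do. -/
theorem logWedgeNu_le_annNu {K : Set F} {t n : ℕ} {U : Set (ExtOmega F)}
    (h : ∀ l : List F, l.length = t → (∀ x ∈ l, x ∈ K ∧ x ≠ 0) → ∀ u ∈ U, logList F l * u = 0) :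
    logWedgeNu F K t ((n : ℤ) - t) ≤ annNu F n U := by
  refine logWedgeNu_le fun k hk l ht hl χ hχ => mem_annNu.2 ⟨?_, fun u hu => ?_⟩
  · have hn : n = t + k := by omega
    rw [hn]
    exact logList_mul_mem_nuPow ht (fun x hx => (hl x hx).2) hχ
  · rw [logList_eq_prod, prod_ι_mul_eq_of_mem (nuPow_le_exteriorPower k hχ), ← logList_eq_prod,
      mul_assoc, mul_assoc, h l ht hl u hu, mul_zero, mul_zero]

end Nu

section Annihilator

open Module

variable {F : Type} [Field F]

theorem dwedge_eq_prod {k : ℕ} (s : Fin k → F) : dwedge F s =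
    ((List.ofFn fun i => KaehlerDifferential.D ℤ F (s i)).map (ι F)).prod := by
  rw [dwedge, List.map_ofFn]
  rfl

theorem dwedge_succ {r : ℕ} (s : Fin (r + 1) → F) :
    dwedge F s = dwedge F (fun i : Fin r => s i.castSucc) * dform F (s (Fin.last r)) := by
  rw [dwedge, List.ofFn_succ', List.concat_eq_append, List.prod_append, List.prod_singleton,
    dwedge]

theorem dwedge_smul {k : ℕ} {s a : Fin k → F} {u : Fin k → F}
    (h : ∀ i, KaehlerDifferential.D ℤ F (s i) = u i • KaehlerDifferential.D ℤ F (a i)) :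
    dwedge F s = (∏ i, u i) • dwedge F a := by
  simp only [dwedge, dform, h]
  exact prod_ofFn_ι_smul u _

theorem dwedge_mul_dform_eq_zero {r : ℕ} {a : Fin r → F} {x : F}
    (hx : KaehlerDifferential.D ℤ F x ∈
      Submodule.span F (Set.range fun i => KaehlerDifferential.D ℤ F (a i))) :
    dwedge F a * dform F x = 0 := by
  have h : dform F x = ([KaehlerDifferential.D ℤ F x].map (ι F)).prod := by simp [dform]
  rw [dwedge_eq_prod, h, ← List.prod_append, ← List.map_append]
  refine prod_ι_eq_zero (fun i => KaehlerDifferential.D ℤ F (a i)) _ (fun y hy => ?_) (by simp)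
  rcases List.mem_append.1 hy with hy | hy
  · obtain ⟨i, rfl⟩ := List.mem_ofFn.1 hy
    exact Submodule.subset_span ⟨i, rfl⟩
  · rw [List.mem_singleton.1 hy]
    exact hx

theorem logList_mul_dwedge_eq_zero {k q : ℕ} (w : Fin k → Ω[F⁄ℤ]) {l : List F} {s : Fin q → F}
    (hl : ∀ x ∈ l, KaehlerDifferential.D ℤ F x ∈ Submodule.span F (Set.range w))
    (hs : ∀ i, KaehlerDifferential.D ℤ F (s i) ∈ Submodule.span F (Set.range w))
    (hk : k < l.length + q) : logList F l * dwedge F s = 0 := by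
  rw [logList_eq_prod, dwedge_eq_prod, ← List.prod_append, ← List.map_append]
  refine prod_ι_eq_zero w _ (fun y hy => ?_) (by simpa using hk)
  rcases List.mem_append.1 hy with hy | hy
  · obtain ⟨x, hx, rfl⟩ := List.mem_map.1 hy
    exact Submodule.smul_mem _ _ (hl x hx)
  · obtain ⟨i, rfl⟩ := List.mem_ofFn.1 hy
    exact hs i

theorem range_D_eq_image {k : ℕ} (a : Fin k → F) :
    (Set.range fun i => KaehlerDifferential.D ℤ F (a i)) =
      KaehlerDifferential.D ℤ F '' Set.range a := by
  rw [← Set.range_comp]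
  rfl

variable {p : ℕ} [hpr : Fact p.Prime] [CharP F p]

theorem exists_D_eq_smul {A : Set F} {a x : F} (hA : pClosure F p A = pClosure F p {a})
    (hx : x ∈ A) : ∃ u : F, KaehlerDifferential.D ℤ F x = u • KaehlerDifferential.D ℤ F a := by
  have h : x ∈ pClosure F p {a} := hA ▸ Subfield.subset_closure (Or.inr hx)
  rw [mem_pClosure_iff, Set.image_singleton, Submodule.mem_span_singleton] at h
  exact h.imp fun _ h => h.symm

/-- A form annihilating `dS₁ ∧ … ∧ dS_{r+1}` annihilates `da₁ ∧ … ∧ da_r ∧ dx` for every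
`x ∈ F^p(a₁, …, a_r)(S_{r+1})`. -/
theorem mul_dwedge_mul_dform_eq_zero {r : ℕ} {S : Fin (r + 1) → Set F} {a : Fin r → F}
    (ha : ∀ i : Fin r, pClosure F p (S i.castSucc) = pClosure F p {a i})
    {s : Fin (r + 1) → F} (hs : ∀ i, s i ∈ S i) (hs0 : dwedge F s ≠ 0) {ω : ExtOmega F}
    (hω : ∀ u ∈ dSet F S, ω * u = 0) {x : F}
    (hx : x ∈ pClosure F p (Set.range a ∪ S (Fin.last r))) :
    ω * (dwedge F a * dform F x) = 0 := by
  choose u hu using fun i : Fin r => exists_D_eq_smul (ha i) (hs i.castSucc)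
  have hprod : (∏ i, u i) ≠ 0 := fun h0 => hs0 (by
    rw [dwedge_succ, dwedge_smul hu, h0, zero_smul, zero_mul])
  let L : Ω[F⁄ℤ] →ₗ[F] ExtOmega F :=
    LinearMap.mulLeft F ω ∘ₗ LinearMap.mulLeft F (dwedge F a) ∘ₗ ι F
  have hL : Submodule.span F (KaehlerDifferential.D ℤ F '' (Set.range a ∪ S (Fin.last r))) ≤
      LinearMap.ker L := by
    rw [Submodule.span_le]
    rintro _ ⟨y, hy | hy, rfl⟩
    · change ω * (dwedge F a * dform F y) = 0
      rw [dwedge_mul_dform_eq_zero, mul_zero]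
      rw [range_D_eq_image]
      exact Submodule.subset_span ⟨y, hy, rfl⟩
    · change ω * (dwedge F a * dform F y) = 0
      have h := hω _ ⟨Fin.snoc (fun i : Fin r => s i.castSucc) y, fun i => ?_, rfl⟩
      · rw [dwedge_succ] at h
        simp only [Fin.snoc_castSucc, Fin.snoc_last] at h
        rw [dwedge_smul hu, smul_mul_assoc, mul_smul_comm] at h
        exact (smul_eq_zero.1 h).resolve_left hprod
      · refine Fin.lastCases ?_ (fun i => ?_) i
        · rw [Fin.snoc_last]
          exact hy
        · rw [Fin.snoc_castSucc]
          exact hs _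
  exact hL ((mem_pClosure_iff _ x).1 hx)

theorem extCoeff_nuPow_closed {I : Type} {b : I → F} {β : Basis I F (Ω[F⁄ℤ])}
    (hb0 : ∀ i, b i ≠ 0) (hβ : ∀ i, β i = (b i)⁻¹ • KaehlerDifferential.D ℤ F (b i)) {n : ℕ}
    {ω : ExtOmega F} (hω : ω ∈ nuPow F n) :
    (∀ t, listDeriv (coordDeriv β) t (fun u => extCoeff β u ω) = 0) ∧
      ∀ t, projList p (coordDeriv β) t (extCoeff β t ω) = extCoeff β t ω ^ p := by
  rw [mem_nuPow_natCast] at hω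
  induction hω using AddSubgroup.closure_induction with
  | mem ω h =>
    obtain ⟨l, -, hl, rfl⟩ := h
    exact extCoeff_logList_closed (coord_D β) (coordDeriv_comm hb0 hβ)
      (coordDeriv_iterate hb0 hβ) l hl
  | zero =>
    refine ⟨fun t => ?_, fun t => ?_⟩
    · have h := listDeriv_sub (D := coordDeriv β) t (fun _ => 0) (fun _ => 0)
      simpa using h
    · rw [map_zero, map_zero, zero_pow hpr.out.ne_zero]
  | add ω η _ _ h h' =>
    refine ⟨fun t => ?_, fun t => ?_⟩
    · simp only [map_add]
      rw [listDeriv_add, h.1, h'.1, add_zero]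
    · rw [map_add, map_add, h.2, h'.2, add_pow_char]
  | neg ω _ h =>
    refine ⟨fun t => ?_, fun t => ?_⟩
    · simp only [map_neg]
      rw [listDeriv_neg, h.1, neg_zero]
    · rw [map_neg, map_neg, h.2]
      exact (map_neg (frobenius F p) _).symm

end Annihilator

section Main

open Module

variable {F : Type} [Field F] {p : ℕ} [hpr : Fact p.Prime] [CharP F p]

theorem range_append {α : Type*} {k l : ℕ} (a : Fin k → α) (e : Fin l → α) :
    Set.range (Fin.append a e) = Set.range a ∪ Set.range e := by
  ext x
  constructor
  · rintro ⟨i, rfl⟩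
    refine Fin.addCases (fun j => ?_) (fun j => ?_) i
    · rw [Fin.append_left]
      exact Or.inl ⟨j, rfl⟩
    · rw [Fin.append_right]
      exact Or.inr ⟨j, rfl⟩
  · rintro (⟨j, rfl⟩ | ⟨j, rfl⟩)
    exacts [⟨_, Fin.append_left a e j⟩, ⟨_, Fin.append_right a e j⟩]

/-- Among the first `l` entries of an increasing list containing `l` elements that lie below
everything outside `T`, there are only elements of `T`. -/
theorem mem_of_mem_take {I : Type} [LinearOrder I] {l : ℕ} {g : Fin l → I}
    (hg : Function.Injective g) {T : Set I} (hT : ∀ j ∉ T, ∀ i, g i < j) {s : List I}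
    (hs : s.Pairwise (· < ·)) (hgs : ∀ i, g i ∈ s) {k : I} (hk : k ∈ s.take l) : k ∈ T := by
  by_contra hkT
  obtain ⟨q, hq, hqk⟩ := List.mem_take_iff_getElem.1 hk
  have hsub : List.ofFn g ⊆ s.take q := by
    intro x hx
    obtain ⟨i, rfl⟩ := List.mem_ofFn.1 hx
    obtain ⟨q', hq', hx'⟩ := List.mem_iff_getElem.1 (hgs i)
    refine List.mem_take_iff_getElem.2 ⟨q', ?_, hx'⟩
    by_contra hlt
    have hqq : q ≤ q' := by omega
    have h1 := hT k hkT i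
    rw [← hx', ← hqk] at h1
    rcases hqq.lt_or_eq with h | h
    · exact absurd (List.pairwise_iff_getElem.1 hs q q' _ hq' h) (not_lt.2 h1.le)
    · subst h
      exact lt_irrefl _ h1
  have := ((List.nodup_ofFn.2 hg).subperm hsub).length_le
  rw [List.length_ofFn, List.length_take] at this
  omega

theorem exists_mem_or_forall_mem_of_extCoeff_ne_zero {r l n : ℕ} {S : Fin (r + 1) → Set F}
    {a : Fin r → F} {e : Fin l → F}
    (ha : ∀ i : Fin r, pClosure F p (S i.castSucc) = pClosure F p {a i})
    (he : pClosure F p (Set.range a ∪ S (Fin.last r)) =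
      pClosure F p (Set.range a ∪ Set.range e))
    {s : Fin (r + 1) → F} (hs : ∀ i, s i ∈ S i) (hs0 : dwedge F s ≠ 0)
    {I : Type} {b : I → F} {β : Basis I F (Ω[F⁄ℤ])} {f : Fin (r + l) → I}
    (hf : Function.Injective f)
    (hβ : ∀ i, β i = (b i)⁻¹ • KaehlerDifferential.D ℤ F (b i))
    (hfb : ∀ i, b (f i) = Fin.append a e i)
    {ω : ExtOmega F} (hω : ω ∈ annNu F n (dSet F S)) {t : List I} (ht : extCoeff β t ω ≠ 0) :
    (∃ i : Fin r, f (Fin.castAdd l i) ∈ t) ∨ ∀ j : Fin l, f (Fin.natAdd r j) ∈ t := by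
  by_contra! hcon
  obtain ⟨ht1, j, hj⟩ := hcon
  obtain ⟨hω1, hω2⟩ := mem_annNu.1 hω
  have hx : e j ∈ pClosure F p (Set.range a ∪ S (Fin.last r)) :=
    he ▸ Subfield.subset_closure (Or.inr (Or.inr ⟨j, rfl⟩))
  have h0 := mul_dwedge_mul_dform_eq_zero ha hs hs0 hω2 hx
  let g : Fin (r + 1) → I := Fin.snoc (fun i => f (Fin.castAdd l i)) (f (Fin.natAdd r j))
  let c : Fin (r + 1) → F := Fin.snoc a (e j)
  have hgc : ∀ i, b (g i) = c i := by
    intro i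
    refine Fin.lastCases ?_ (fun i => ?_) i
    · simp only [g, c, Fin.snoc_last, hfb, Fin.append_right]
    · simp only [g, c, Fin.snoc_castSucc, hfb, Fin.append_left]
  have hginj : Function.Injective g := by
    refine Fin.snoc_injective_iff.2 ⟨?_, ?_⟩
    · exact hf.comp (Fin.castAdd_injective r l)
    · rintro ⟨i, hi⟩
      have := congrArg Fin.val (hf hi)
      simp at this
      omega
  have hnodup : (List.ofFn g ++ t).Nodup := by
    refine List.Nodup.append (List.nodup_ofFn.2 hginj) (nodup_of_extCoeff_ne_zero β ht) ?_
    intro x hx hxt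
    obtain ⟨i, rfl⟩ := List.mem_ofFn.1 hx
    revert hxt
    refine Fin.lastCases ?_ (fun i => ?_) i
    · simpa only [g, Fin.snoc_last] using hj
    · simpa only [g, Fin.snoc_castSucc] using ht1 i
  have hprod : basisProd β (List.ofFn g) =
      (∏ i, (c i)⁻¹) • (dwedge F a * dform F (e j)) := by
    have h1 : dwedge F a * dform F (e j) = dwedge F c := by
      rw [dwedge_succ]
      simp only [c, Fin.snoc_castSucc, Fin.snoc_last]
    rw [h1, dwedge, basisProd, List.map_ofFn]
    simp only [dform, Function.comp_def, hβ, hgc]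
    exact prod_ofFn_ι_smul _ _
  apply ht
  rw [← extCoeff_basisProd_mul β hnodup]
  have h2 : basisProd β (List.ofFn g) * ω = 0 := by
    have h3 : basisProd β (List.ofFn g) = (((List.ofFn g).map β).map (ι F)).prod := by
      rw [basisProd, List.map_map]
      rfl
    rw [h3, prod_ι_mul_eq_zero_iff (nuPow_le_exteriorPower n hω1), ← h3, hprod, mul_smul_comm,
      h0, smul_zero]
  rw [h2, map_zero]

theorem annNu_dSet_eq (hF : ∀ x : F, ∃ y : F, y ^ (p - 1) = x) {r l : ℕ} (n : ℕ) (hl : 0 < l)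
    {S : Fin (r + 1) → Set F} {a : Fin r → F} {e : Fin l → F}
    (hind : LinearIndependent F fun i => KaehlerDifferential.D ℤ F (Fin.append a e i))
    (ha : ∀ i : Fin r, pClosure F p (S i.castSucc) = pClosure F p {a i})
    (he : pClosure F p (Set.range a ∪ S (Fin.last r)) =
      pClosure F p (Set.range a ∪ Set.range e))
    {s : Fin (r + 1) → F} (hs : ∀ i, s i ∈ S i) (hs0 : dwedge F s ≠ 0) :
    annNu F n (dSet F S) =
      logWedgeNu F (pClosure F p (Set.range a)) 1 ((n : ℤ) - 1) ⊔
        logWedgeNu F (pClosure F p (Set.range a ∪ Set.range e)) l ((n : ℤ) - l) := by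
  have hS : ∀ i : Fin r, ∀ x ∈ S i.castSucc, KaehlerDifferential.D ℤ F x ∈
      Submodule.span F (KaehlerDifferential.D ℤ F '' Set.range a) := by
    intro i x hx
    obtain ⟨u, hu⟩ := exists_D_eq_smul (ha i) hx
    rw [hu]
    exact Submodule.smul_mem _ _ (Submodule.subset_span ⟨a i, ⟨i, rfl⟩, rfl⟩)
  have hGN : logWedgeNu F (pClosure F p (Set.range a)) 1 ((n : ℤ) - 1) ⊔
      logWedgeNu F (pClosure F p (Set.range a ∪ Set.range e)) l ((n : ℤ) - l) ≤
        annNu F n (dSet F S) := by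
    refine sup_le ?_ ?_
    · refine logWedgeNu_le_annNu (t := 1) fun l hl hlK u hu => ?_
      obtain ⟨s', hs', rfl⟩ := hu
      rw [dwedge_succ, ← mul_assoc,
        logList_mul_dwedge_eq_zero (fun i => KaehlerDifferential.D ℤ F (a i)), zero_mul]
      · intro x hx
        rw [range_D_eq_image]
        exact (mem_pClosure_iff _ x).1 (hlK x hx).1
      · intro i
        rw [range_D_eq_image]
        exact hS i _ (hs' _)
      · omega
    · refine logWedgeNu_le_annNu fun l' hl' hlK u hu => ?_
      obtain ⟨s', hs', rfl⟩ := hu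
      refine logList_mul_dwedge_eq_zero
        (fun i => KaehlerDifferential.D ℤ F (Fin.append a e i)) ?_ ?_ (by omega)
      · intro x hx
        rw [range_D_eq_image, range_append]
        exact (mem_pClosure_iff _ x).1 (hlK x hx).1
      · intro i
        rw [range_D_eq_image, range_append]
        refine Fin.lastCases ?_ (fun i => ?_) i
        · refine (mem_pClosure_iff (p := p) _ _).1 ?_
          rw [← he]
          exact Subfield.subset_closure (Or.inr (Or.inr (hs' _)))
        · exact Submodule.span_mono (Set.image_mono Set.subset_union_left) (hS i _ (hs' _))
  refine le_antisymm ?_ hGN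
  obtain ⟨I, _, _, b, β, f, hb0, hβ, hf, hfb, hfj⟩ := exists_ordered_basis hind
  have hmem : ∀ ω ∈ annNu F n (dSet F S), ∀ t, extCoeff β t ω ≠ 0 →
      (∃ i : Fin r, f (Fin.castAdd l i) ∈ t) ∨ ∀ j : Fin l, f (Fin.natAdd r j) ∈ t :=
    fun ω hω t ht => exists_mem_or_forall_mem_of_extCoeff_ne_zero ha he hs hs0 hf.injective hβ hfb
      hω ht
  refine le_of_leading_forms (p := p) (coord_D β) (coordDeriv_comm hb0 hβ)
    (coordDeriv_iterate hb0 hβ) hb0 (coordDeriv_self hb0 hβ) (coordDeriv_of_ne hb0 hβ) hF hGN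
    (fun ω hω => (extCoeff_nuPow_closed hb0 hβ (mem_annNu.1 hω).1).1)
    (fun ω hω => (extCoeff_nuPow_closed hb0 hβ (mem_annNu.1 hω).1).2) ?_ ?_
  · intro ω hω
    by_contra h
    rcases hmem ω hω [] h with ⟨i, hi⟩ | h
    · simp at hi
    · simpa using h ⟨0, hl⟩
  · rintro t ht ⟨ω, hω, hωt⟩ y hy
    have hlen := length_of_extCoeff_ne_zero β (nuPow_le_exteriorPower n (mem_annNu.1 hω).1) hωt
    by_cases hcase : ∃ i : Fin r, f (Fin.castAdd l i) ∈ t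
    · obtain ⟨i, hi⟩ := hcase
      refine AddSubgroup.mem_sup_left ?_
      cases t with
      | nil => simp at hi
      | cons k t =>
        have hk : k ≤ f (Fin.castAdd l i) := by
          rcases List.mem_cons.1 hi with h | h
          · exact h.ge
          · exact ((List.pairwise_cons.1 ht).1 _ h).le
        have hyk : y k ∈ pClosure F p (Set.range a) := by
          have h := mem_pClosure_of_coordDeriv (p := p) hβ
            (T := Set.range fun i => f (Fin.castAdd l i)) (y := y k) fun j hj => ?_
          · refine pClosure_mono ?_ h
            rintro _ ⟨_, ⟨i', rfl⟩, rfl⟩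
            rw [hfb, Fin.append_left]
            exact ⟨i', rfl⟩
          · refine (hy k List.mem_cons_self).2 j (hk.trans_lt ?_)
            by_cases hjf : j ∈ Set.range f
            · obtain ⟨j', rfl⟩ := hjf
              refine hf ?_
              revert hj
              refine Fin.addCases (fun j => ?_) (fun j => ?_) j'
              · exact fun hj => absurd ⟨j, rfl⟩ hj
              · intro _
                rw [Fin.lt_def, Fin.val_castAdd, Fin.val_natAdd]
                omega
            · exact hfj j hjf _
        have hn : (n : ℤ) - 1 = (t.length : ℤ) := by
          rw [List.length_cons] at hlen
          omega
        rw [hn, List.map_cons, ← List.singleton_append]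
        refine logList_append_mem_logWedgeNu rfl (by simp) (fun x hx => ?_) fun x hx => ?_
        · rw [List.mem_singleton.1 hx]
          exact ⟨hyk, (hy k List.mem_cons_self).1⟩
        · obtain ⟨j, hj, rfl⟩ := List.mem_map.1 hx
          exact (hy j (List.mem_cons_of_mem _ hj)).1
    · refine AddSubgroup.mem_sup_right ?_
      have hE := (hmem ω hω t hωt).resolve_left hcase
      have hfE : Function.Injective fun j => f (Fin.natAdd r j) :=
        hf.injective.comp (Fin.natAdd_injective l r)
      have hln : l ≤ t.length := by
        have := ((List.nodup_ofFn.2 hfE).subperm (l₂ := t) fun x hx => by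
          obtain ⟨j, rfl⟩ := List.mem_ofFn.1 hx
          exact hE j).length_le
        simpa using this
      have hn : (n : ℤ) - l = ((t.length - l : ℕ) : ℤ) := by omega
      rw [hn, ← List.take_append_drop l t, List.map_append]
      refine logList_append_mem_logWedgeNu (by simpa using hln) (by simp) (fun x hx => ?_)
        fun x hx => ?_
      · obtain ⟨k, hk, rfl⟩ := List.mem_map.1 hx
        refine ⟨?_, (hy k (List.mem_of_mem_take hk)).1⟩
        obtain ⟨i, rfl⟩ := mem_of_mem_take hfE (fun j hj i => hfj j hj _) ht hE hk
        have h := mem_pClosure_of_coordDeriv (p := p) hβ (T := Set.range f) (y := y (f i))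
          fun j hj => (hy _ (List.mem_of_mem_take hk)).2 j (hfj j hj i)
        rw [← range_append]
        refine pClosure_mono ?_ h
        rintro _ ⟨_, ⟨i', rfl⟩, rfl⟩
        exact ⟨i', (hfb i').symm⟩
      · obtain ⟨k, hk, rfl⟩ := List.mem_map.1 hx
        exact (hy k (List.mem_of_mem_drop hk)).1

end Main

/-- Theorem 4.3(a). Assume `F^{p−1} = F`; in the situation of
Proposition 3.6 (`pdeg Sᵢ = 1` for `i ≤ r`, `dS₁ ∧ … ∧ dS_{r+1} ≠ {0}`,
`pdeg(S₁ ∪ … ∪ S_{r+1}) = r + ℓ`) one has `ℓ ≥ 1` and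
`ann ν^n_F(dS₁ ∧ … ∧ dS_{r+1}) = [dx/x ∣ x ∈ F^p(a₁,…,a_r)^*] ∧ ν_{n−1}(F)
 + [dy₁/y₁ ∧ … ∧ dy_ℓ/y_ℓ ∣ yᵢ ∈ F^p(a₁,…,a_r,e₁,…,e_ℓ)^*] ∧ ν_{n−ℓ}(F)`. -/
theorem stmt12 (F : Type) [Field F] (p : ℕ) [Fact p.Prime] [CharP F p]
    (hF : ∀ x : F, ∃ y : F, y ^ (p - 1) = x)
    (n r m : ℕ) (S : Fin (r + 1) → Set F) (hS : ∀ i, (S i).Nonempty)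
    (hdeg1 : ∀ i : Fin r, pDegEq F p (S i.castSucc) 1)
    (hne : dSet F S ≠ {0})
    (hm : pDegEq F p (⋃ i, S i) m) :
    r + 1 ≤ m ∧
      ∀ (a : Fin r → F) (e : Fin (m - r) → F),
        pIndep F p (Fin.append a e) →
        (∀ i : Fin r, pClosure F p (S i.castSucc) = pClosure F p {a i}) →
        pClosure F p (Set.range a ∪ S (Fin.last r)) =
          pClosure F p (Set.range a ∪ Set.range e) →
        annNu F n (dSet F S) =
          logWedgeNu F (pClosure F p (Set.range a)) 1 ((n : ℤ) - 1) ⊔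
            logWedgeNu F (pClosure F p (Set.range a ∪ Set.range e)) (m - r)
              ((n : ℤ) - (m - r)) := by
  obtain ⟨s, hs, hs0⟩ : ∃ s : Fin (r + 1) → F, (∀ i, s i ∈ S i) ∧ dwedge F s ≠ 0 := by
    by_contra! h
    choose s hs using hS
    refine hne (Set.eq_singleton_iff_unique_mem.2 ⟨⟨s, hs, (h s hs).symm⟩, ?_⟩)
    rintro _ ⟨s', hs', rfl⟩
    exact h s' hs'
  have hrm : r + 1 ≤ m :=
    card_le_of_pDegEq hm (fun i => Set.mem_iUnion.2 ⟨i, hs i⟩)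
      (linearIndependent_of_prod_ι_ne_zero hs0)
  refine ⟨hrm, fun a e hae ha he => ?_⟩
  rw [← Nat.cast_sub (by omega : r ≤ m)]
  exact annNu_dSet_eq hF n (by omega) (linearIndependent_of_pIndep hae) ha he hs hs0
end

section
/- Let F be a field of characteristic p > 0, let α be an element of an algebraic closure of F that is algebraic and not separable over F, and set K = F(α). Let C_F(α) be the set of nonzero coefficients of the monic minimal polynomial of α over F. Then Ω^n(K/F) = annΩ^n_F(d C_F(α)) and ν_n(K/F) = ann ν^n_F(d C_F(α)). -/
set_option synthInstance.maxHeartbeats 1000000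
set_option maxHeartbeats 1000000

open ExteriorAlgebra

section

open Polynomial TensorProduct

/-- A derivation extends to a simple algebraic extension `k[a]`, with prescribed value at `a`,
as soon as the minimal polynomial of `a` imposes no obstruction. -/
theorem exists_derivation_extending {k K M : Type*} [Field k] [Field K] [Algebra k K]
    [AddCommGroup M] [Module K M] [Module k M] [IsScalarTower k K M]
    (a : K) (ha : Algebra.adjoin k {a} = ⊤) (δ : Derivation ℤ k M) (m : M)
    (h : (minpoly k a).sum (fun i c => a ^ i • δ c)
      + aeval a (derivative (minpoly k a)) • m = 0) :
    ∃ D : Derivation ℤ K M, (∀ c, D (algebraMap k K c) = δ c) ∧ D a = m := by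
  let : Module Kᵐᵒᵖ M := Module.compHom M ((RingHom.id K).fromOpposite mul_comm)
  have : IsCentralScalar K M := ⟨fun r m => rfl⟩
  let φ : k →+* TrivSqZeroExt K M :=
    { toFun := fun c => TrivSqZeroExt.inl (algebraMap k K c) + TrivSqZeroExt.inr (δ c)
      map_one' := by ext <;> simp
      map_zero' := by ext <;> simp
      map_add' := fun x y => by ext <;> simp
      map_mul' := fun x y => by ext <;> simp [algebraMap_smul] }
  let Θ : k[X] →+* TrivSqZeroExt K M :=
    eval₂RingHom φ (TrivSqZeroExt.inl a + TrivSqZeroExt.inr m)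
  have hpow (i : ℕ) : (TrivSqZeroExt.inl a + TrivSqZeroExt.inr m : TrivSqZeroExt K M) ^ i
      = TrivSqZeroExt.inl (a ^ i) + TrivSqZeroExt.inr ((i * a ^ (i - 1)) • m) := by
    ext
    · simp
    · simp [TrivSqZeroExt.snd_pow, mul_smul, ← Nat.cast_smul_eq_nsmul K]
  have hΘfst (g : k[X]) : (Θ g).fst = aeval a g := by
    have : (TrivSqZeroExt.fstHom k K M : TrivSqZeroExt K M →+* K).comp Θ
        = (aeval a : k[X] →ₐ[k] K).toRingHom := by
      ext <;> simp [Θ, φ]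
    exact RingHom.congr_fun this g
  have hΘsnd (g : k[X]) : (Θ g).snd
      = g.sum (fun i c => a ^ i • δ c) + aeval a (derivative g) • m := by
    induction g using Polynomial.induction_on' with
    | add p q hp hq =>
      rw [map_add, TrivSqZeroExt.snd_add, hp, hq, Polynomial.sum_add_index, derivative_add, map_add,
        add_smul]
      · abel
      · simp
      · simp
    | monomial n c =>
      simp only [Θ, coe_eval₂RingHom, eval₂_monomial, hpow]
      rw [Polynomial.sum_monomial_index _ _ (by simp), derivative_monomial]
      simp only [φ, RingHom.coe_mk, MonoidHom.coe_mk, OneHom.coe_mk, aeval_monomial]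
      simp only [mul_smul, mul_assoc, add_comm, map_mul, map_natCast,
        TrivSqZeroExt.snd_mul, TrivSqZeroExt.fst_add, TrivSqZeroExt.fst_inl,
        TrivSqZeroExt.fst_inr, TrivSqZeroExt.snd_add, TrivSqZeroExt.snd_inl,
        TrivSqZeroExt.snd_inr, add_zero, zero_add, op_smul_eq_smul]
  have hsurj : Function.Surjective (aeval a : k[X] →ₐ[k] K).toRingHom := by
    intro x
    have : x ∈ Algebra.adjoin k {a} := ha ▸ trivial
    rw [Algebra.adjoin_singleton_eq_range_aeval] at this
    exact this
  have hker : RingHom.ker (aeval a : k[X] →ₐ[k] K).toRingHom ≤ RingHom.ker Θ := by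
    intro g hg
    obtain ⟨q, rfl⟩ := minpoly.dvd k a hg
    have : Θ (minpoly k a) = 0 := by
      ext
      · simp [hΘfst]
      · rw [hΘsnd, h]; rfl
    rw [RingHom.mem_ker, map_mul, this, zero_mul]
  let Ψ : K →+* TrivSqZeroExt K M := RingHom.liftOfSurjective _ hsurj ⟨Θ, hker⟩
  have hΨ (g : k[X]) : Ψ (aeval a g) = Θ g :=
    RingHom.liftOfRightInverse_comp_apply _ _ (Function.rightInverse_surjInv hsurj) ⟨Θ, hker⟩ g
  have hΨfst (x : K) : (Ψ x).fst = x := by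
    obtain ⟨g, rfl⟩ := hsurj x
    exact (congrArg _ (hΨ g)).trans (hΘfst g)
  refine ⟨Derivation.mk' (AddMonoidHom.toIntLinearMap
    { toFun := fun x => (Ψ x).snd, map_zero' := by simp, map_add' := by simp }) ?_, ?_, ?_⟩
  · intro x y
    simp [hΨfst]
  · intro c
    change (Ψ _).snd = _
    have := hΨ (C c)
    rw [aeval_C] at this
    simp [this, Θ, φ]
  · change (Ψ _).snd = _
    have := hΨ X
    rw [aeval_X] at this
    simp [this, Θ]

/-- In characteristic `p`, the differential of an element that is not a `p`-th power is nonzero. -/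
theorem kaehlerDifferential_D_ne_zero {F : Type*} [Field F] (p : ℕ) [Fact p.Prime] [CharP F p]
    {c : F} (hc : ∀ b, b ^ p ≠ c) : KaehlerDifferential.D ℤ F c ≠ 0 := by
  have hp : p.Prime := Fact.out
  obtain ⟨L, -, ⟨hLp, hLc⟩, hmax⟩ := zorn_le_nonempty₀
      {L : Subfield F | (∀ x, x ^ p ∈ L) ∧ c ∉ L} (by
    intro S hS hchain L₀ hL₀
    refine ⟨sSup S, ⟨fun x => ?_, fun h => ?_⟩, fun L hL => le_sSup hL⟩
    · exact le_sSup hL₀ ((hS hL₀).1 x)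
    · obtain ⟨L, hL, hcL⟩ := (Subfield.mem_sSup_of_directedOn ⟨L₀, hL₀⟩ hchain.directedOn).1 h
      exact (hS hL).2 hcL) (frobenius F p).fieldRange
      ⟨fun x => ⟨x, rfl⟩, fun ⟨b, hb⟩ => hc b hb⟩
  have heval (x : F) : aeval x (X ^ p - C (⟨x ^ p, hLp x⟩ : L)) = 0 := by
    rw [map_sub, map_pow, aeval_X, aeval_C, sub_eq_zero]
    rfl
  have hmin (x : F) (hx : x ∉ L) : minpoly L x = X ^ p - C (⟨x ^ p, hLp x⟩ : L) := by
    refine (minpoly.eq_of_irreducible_of_monic ?_ ?_ (monic_X_pow_sub_C _ hp.ne_zero)).symm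
    · refine X_pow_sub_C_irreducible_of_prime hp fun b hb => hx ?_
      have : (b : F) ^ p = x ^ p := congrArg Subtype.val hb
      rw [← frobenius_inj F p this]
      exact b.2
    · simp [heval]
  have hint (x : F) : IsIntegral L x :=
    ⟨X ^ p - C (⟨x ^ p, hLp x⟩ : L), monic_X_pow_sub_C _ hp.ne_zero, heval x⟩
  have hdeg (x : F) (hx : x ∉ L) : Module.finrank L (IntermediateField.adjoin L {x}) = p := by
    rw [IntermediateField.adjoin.finrank (hint x), hmin x hx, natDegree_X_pow_sub_C]
  have htop : Algebra.adjoin L {c} = ⊤ := by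
    rw [← IntermediateField.adjoin_simple_toSubalgebra_of_isAlgebraic (hint c).isAlgebraic]
    rw [eq_top_iff]
    intro x _
    by_cases hx : x ∈ L
    · exact IntermediateField.algebraMap_mem _ (⟨x, hx⟩ : L)
    have hcx : c ∈ IntermediateField.adjoin L {x} := by
      by_contra hcon
      have hle : L ≤ (IntermediateField.adjoin L {x}).toSubfield :=
        fun y hy => IntermediateField.algebraMap_mem _ (⟨y, hy⟩ : L)
      exact hx (hmax ⟨fun y => hle (hLp y), hcon⟩ hle
        (IntermediateField.mem_adjoin_simple_self L x))
    have : FiniteDimensional L (IntermediateField.adjoin L {x}) :=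
      IntermediateField.adjoin.finiteDimensional (hint x)
    have := IntermediateField.eq_of_le_of_finrank_eq
      (IntermediateField.adjoin_simple_le_iff.2 hcx) (by rw [hdeg x hx, hdeg c hLc])
    change x ∈ IntermediateField.adjoin L {c}
    rw [this]
    exact IntermediateField.mem_adjoin_simple_self L x
  obtain ⟨D, -, hD⟩ := exists_derivation_extending (k := L) c htop (0 : Derivation ℤ L F) 1 (by
    rw [hmin c hLc]
    simp [Polynomial.sum, derivative_X_pow])
  intro h0
  have := D.liftKaehlerDifferential_comp_D c
  rw [h0, map_zero, hD] at this
  exact zero_ne_one this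

theorem exists_coeff_D_ne_zero {F : Type*} [Field F] (p : ℕ) [Fact p.Prime] [CharP F p]
    {f : F[X]} (hf : Irreducible f) (hsep : ¬ f.Separable) :
    ∃ i, KaehlerDifferential.D ℤ F (f.coeff i) ≠ 0 := by
  have hp : p.Prime := Fact.out
  by_contra! hcon
  have hpow (i : ℕ) : ∃ b, b ^ p = f.coeff i := by
    by_contra! hb
    exact kaehlerDifferential_D_ne_zero p hb (hcon i)
  have hder : derivative f = 0 := by
    by_contra h
    exact hsep ((separable_iff_derivative_ne_zero hf).2 h)
  have hexp := expand_contract p hder hp.ne_zero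
  obtain ⟨g, hg⟩ : contract p f ∈ lifts (frobenius F p) := by
    rw [lifts_iff_coeff_lifts]
    intro i
    rw [coeff_contract hp.ne_zero]
    exact hpow _
  have : f = g ^ p := by
    rw [← map_frobenius_expand p, map_expand, ← coe_mapRingHom, hg, hexp]
  exact not_irreducible_pow hp.ne_one (this ▸ hf)

theorem resMap_ι (F E : Type) [Field F] [Field E] [Algebra F E] (v : Ω[F⁄ℤ]) :
    resMap F E (ExteriorAlgebra.ι F v)
      = ExteriorAlgebra.ι E (KaehlerDifferential.map ℤ ℤ F E v) := by
  let : Algebra F (ExtOmega E) :=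
    ((algebraMap E (ExtOmega E)).comp (algebraMap F E)).toAlgebra'
      (fun c x => Algebra.commutes (algebraMap F E c) x)
  exact ExteriorAlgebra.lift_ι_apply _ _ _ _

theorem resMap_algebraMap (F E : Type) [Field F] [Field E] [Algebra F E] (c : F) :
    resMap F E (algebraMap F (ExtOmega F) c)
      = algebraMap E (ExtOmega E) (algebraMap F E c) := by
  let : Algebra F (ExtOmega E) :=
    ((algebraMap E (ExtOmega E)).comp (algebraMap F E)).toAlgebra'
      (fun c x => Algebra.commutes (algebraMap F E c) x)
  exact AlgHom.commutes (ExteriorAlgebra.lift F _) c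

theorem resMap_smul (F E : Type) [Field F] [Field E] [Algebra F E] (c : F) (x : ExtOmega F) :
    resMap F E (c • x) = algebraMap F E c • resMap F E x := by
  rw [Algebra.smul_def, map_mul, resMap_algebraMap, Algebra.smul_def]

theorem resMap_dform (F E : Type) [Field F] [Field E] [Algebra F E] (c : F) :
    resMap F E (dform F c) = dform E (algebraMap F E c) := by
  rw [dform, resMap_ι, KaehlerDifferential.map_D, dform]

/-- A derivation applied to a polynomial relation `f(a) = 0`. -/
theorem Derivation.sum_pow_smul_add_derivative_smul {k K M : Type*} [Field k] [Field K]
    [Algebra k K] [AddCommGroup M] [Module K M] (D : Derivation ℤ K M) (a : K) (f : k[X]) :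
    f.sum (fun i c => a ^ i • D (algebraMap k K c)) + aeval a (derivative f) • D a
      = D (aeval a f) := by
  induction f using Polynomial.induction_on' with
  | add p q hp hq =>
    rw [map_add (aeval a) p q, map_add D, ← hp, ← hq, Polynomial.sum_add_index, derivative_add,
      map_add, add_smul]
    · abel
    · simp
    · simp
  | monomial n c =>
    rw [Polynomial.sum_monomial_index _ _ (by simp), derivative_monomial, aeval_monomial,
      aeval_monomial, D.leibniz, D.leibniz_pow]
    simp [mul_smul, ← Nat.cast_smul_eq_nsmul K, add_comm]

theorem LinearIndependent.eq_zero_of_sum_tmul_eq_zero {F V W ι : Type*} [Field F]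
    [AddCommGroup V] [Module F V] [AddCommGroup W] [Module F W] [Fintype ι] {v : ι → V}
    (hv : LinearIndependent F v) {w : ι → W} (h : ∑ i, v i ⊗ₜ[F] w i = 0) (i : ι) : w i = 0 := by
  classical
  obtain ⟨g, hg⟩ := (Fintype.linearCombination F v).exists_leftInverse_of_injective
    (LinearMap.ker_eq_bot.2 hv.fintypeLinearCombination_injective)
  have hgv (j : ι) : g (v j) = Pi.single j 1 := by
    simpa using LinearMap.congr_fun hg (Pi.single j 1)
  have := congrArg (TensorProduct.lid F W ∘ ((LinearMap.proj i).comp g).rTensor W) h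
  simpa [hgv, Pi.single_apply] using this

section BaseChange

variable {F : Type*} (K : Type*) {V : Type*} [Field F] [Field K] [Algebra F K]
  [AddCommGroup V] [Module F V]

/-- The inclusion `K ⊗ V → K ⊗ ⋀V` in degree one. -/
noncomputable def baseChangeι : K ⊗[F] V →ₗ[K] K ⊗[F] ExteriorAlgebra F V :=
  (ExteriorAlgebra.ι F).baseChange K

theorem baseChangeι_mul_swap (x y : K ⊗[F] V) :
    baseChangeι K x * baseChangeι K y = -(baseChangeι K y * baseChangeι K x) := by
  induction x with
  | zero => simp
  | add x x' hx hx' => simp only [map_add, add_mul, mul_add, hx, hx', neg_add]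
  | tmul a v =>
    induction y with
    | zero => simp
    | add y y' hy hy' => simp only [map_add, add_mul, mul_add, hy, hy', neg_add]
    | tmul b w =>
      simp only [baseChangeι, LinearMap.baseChange_tmul, Algebra.TensorProduct.tmul_mul_tmul]
      rw [mul_comm b a, ← TensorProduct.tmul_neg,
        eq_neg_of_add_eq_zero_left (ExteriorAlgebra.ι_add_mul_swap v w)]

theorem baseChangeι_mul_self (x : K ⊗[F] V) : baseChangeι K x * baseChangeι K x = 0 := by
  induction x with
  | zero => simp
  | add x y hx hy =>
    rw [map_add, add_mul, mul_add, mul_add, hx, hy, baseChangeι_mul_swap K x y]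
    abel
  | tmul a v => simp [baseChangeι]

end BaseChange

/-- The element `∑ αⁱ ⊗ d cᵢ`, where the `cᵢ` are the coefficients of the minimal polynomial
of `α`. -/
noncomputable def minpolyDiff (F : Type*) {K : Type*} [Field F] [Field K] [Algebra F K] (a : K) :
    K ⊗[F] Ω[F⁄ℤ] :=
  ∑ i ∈ Finset.range (minpoly F a).natDegree,
    (a ^ i) ⊗ₜ[F] KaehlerDifferential.D ℤ F ((minpoly F a).coeff i)

section

variable {F K : Type} [Field F] [Field K] [Algebra F K]

theorem minpoly_sum_pow_smul_derivation {M : Type*} [AddCommGroup M] [Module F M] {a : K} (ha : IsIntegral F a)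
    (δ : Derivation ℤ F M) {N : Type*} [AddCommGroup N] [Module K N] (g : M →+ N) :
    (minpoly F a).sum (fun i c => a ^ i • g (δ c))
      = ∑ i ∈ Finset.range (minpoly F a).natDegree, a ^ i • g (δ ((minpoly F a).coeff i)) := by
  rw [Polynomial.sum_over_range _ (by simp), Finset.sum_range_succ,
    coeff_natDegree, (minpoly.monic ha).leadingCoeff]
  simp

theorem sum_pow_smul_dform_coeff {a : K} (ha : IsIntegral F a)
    (hder : derivative (minpoly F a) = 0) :
    ∑ i ∈ Finset.range (minpoly F a).natDegree,
      a ^ i • resMap F K (dform F ((minpoly F a).coeff i)) = 0 := by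
  have h := Derivation.sum_pow_smul_add_derivative_smul (KaehlerDifferential.D ℤ K) a (minpoly F a)
  rw [hder, minpoly.aeval, map_zero, map_zero, zero_smul, add_zero] at h
  simp_rw [← KaehlerDifferential.map_D ℤ ℤ F K] at h
  have h' := congrArg (ExteriorAlgebra.ι K) ((minpoly_sum_pow_smul_derivation ha (KaehlerDifferential.D ℤ F)
    ((KaehlerDifferential.map ℤ ℤ F K).toAddMonoidHom)).symm.trans h)
  simpa [dform, resMap_ι, map_sum] using h'

theorem resMap_eq_zero_of_mul_dform_coeff {a : K} (ha : IsIntegral F a)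
    (hder : derivative (minpoly F a) = 0)
    {ℓ : Module.Dual F Ω[F⁄ℤ]}
    (hℓ : ∑ i ∈ Finset.range (minpoly F a).natDegree,
      a ^ i * algebraMap F K (ℓ (KaehlerDifferential.D ℤ F ((minpoly F a).coeff i))) ≠ 0)
    {ω : ExtOmega F} (hω : ∀ i, ω * dform F ((minpoly F a).coeff i) = 0) :
    resMap F K ω = 0 := by
  refine (smul_eq_zero_iff_right hℓ).1 ?_
  have key (i : ℕ) :
      algebraMap F K (ℓ (KaehlerDifferential.D ℤ F ((minpoly F a).coeff i))) • resMap F K ω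
        = resMap F K (CliffordAlgebra.contractRight ω ℓ)
          * resMap F K (dform F ((minpoly F a).coeff i)) := by
    have h := CliffordAlgebra.contractRight_mul_ι (Q := (0 : QuadraticForm F Ω[F⁄ℤ])) (d := ℓ)
      (KaehlerDifferential.D ℤ F ((minpoly F a).coeff i)) ω
    have h0 : ω * CliffordAlgebra.ι (0 : QuadraticForm F Ω[F⁄ℤ])
      (KaehlerDifferential.D ℤ F ((minpoly F a).coeff i)) = 0 := hω i
    rw [h0, map_zero, LinearMap.zero_apply, eq_comm, sub_eq_zero] at h
    rw [← resMap_smul, h, map_mul]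
    rfl
  rw [Finset.sum_smul]
  simp_rw [mul_smul, key, ← mul_smul_comm]
  rw [← Finset.mul_sum, sum_pow_smul_dform_coeff ha hder, mul_zero]

/-- After multiplication by `∑ αⁱ ⊗ d cᵢ`, the base change map `ω ↦ 1 ⊗ ω` factors through the
restriction map. -/
theorem exists_algHom_resMap_mul {a : K} (ha : IsIntegral F a) (htop : Algebra.adjoin F {a} = ⊤)
    {ℓ : Module.Dual F Ω[F⁄ℤ]}
    (hℓ : ∑ i ∈ Finset.range (minpoly F a).natDegree,
      a ^ i * algebraMap F K (ℓ (KaehlerDifferential.D ℤ F ((minpoly F a).coeff i))) ≠ 0) :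
    ∃ Ψ : ExtOmega K →ₐ[K] K ⊗[F] ExtOmega F, ∀ ω : ExtOmega F,
      Ψ (resMap F K ω) * baseChangeι K (minpolyDiff F a)
        = (1 ⊗ₜ ω) * baseChangeι K (minpolyDiff F a) := by
  set κ : K := ∑ i ∈ Finset.range (minpoly F a).natDegree,
      a ^ i * algebraMap F K (ℓ (KaehlerDifferential.D ℤ F ((minpoly F a).coeff i))) with hκ
  set u := minpolyDiff F a with hu
  let g : Ω[F⁄ℤ] →ₗ[F] K ⊗[F] Ω[F⁄ℤ] :=
    TensorProduct.mk F K Ω[F⁄ℤ] 1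
      - ((Algebra.linearMap F K).comp ℓ).smulRight (κ⁻¹ • u)
  have hg (v : Ω[F⁄ℤ]) : g v = 1 ⊗ₜ v - (algebraMap F K (ℓ v) * κ⁻¹) • u := by
    simp [g, mul_smul]
  obtain ⟨D, hD, -⟩ := exists_derivation_extending a htop
    (g.compDer (KaehlerDifferential.D ℤ F)) 0 (by
      rw [smul_zero, add_zero]
      refine (minpoly_sum_pow_smul_derivation ha (g.compDer (KaehlerDifferential.D ℤ F))
        (AddMonoidHom.id _)).trans ?_
      change ∑ i ∈ Finset.range (minpoly F a).natDegree,
        a ^ i • g (KaehlerDifferential.D ℤ F ((minpoly F a).coeff i)) = 0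
      simp only [hg, smul_sub, Finset.sum_sub_distrib]
      have h1 : ∑ i ∈ Finset.range (minpoly F a).natDegree,
          a ^ i • ((1 : K) ⊗ₜ[F] KaehlerDifferential.D ℤ F ((minpoly F a).coeff i)) = u := by
        simp [hu, minpolyDiff, TensorProduct.smul_tmul']
      simp_rw [← mul_smul, ← mul_assoc]
      rw [h1, ← Finset.sum_smul, ← Finset.sum_mul, ← hκ, mul_inv_cancel₀ hℓ, one_smul, sub_self])
  have hs (v : Ω[F⁄ℤ]) : D.liftKaehlerDifferential (KaehlerDifferential.map ℤ ℤ F K v) = g v := by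
    have : (D.liftKaehlerDifferential.restrictScalars F).comp (KaehlerDifferential.map ℤ ℤ F K)
        = g := by
      apply Derivation.liftKaehlerDifferential_unique
      ext c
      simp [hD]
    exact LinearMap.congr_fun this v
  let Ψ : ExtOmega K →ₐ[K] K ⊗[F] ExtOmega F :=
    ExteriorAlgebra.lift K ⟨(baseChangeι K).comp D.liftKaehlerDifferential,
      fun m => baseChangeι_mul_self K _⟩
  have hι (v : Ω[F⁄ℤ]) : Ψ (resMap F K (ExteriorAlgebra.ι F v)) = baseChangeι K (g v) := by
    rw [resMap_ι, ExteriorAlgebra.lift_ι_apply, LinearMap.comp_apply, hs]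
  refine ⟨Ψ, fun ω => ?_⟩
  induction ω using CliffordAlgebra.right_induction with
  | algebraMap c =>
    have : Ψ (resMap F K (algebraMap F (ExtOmega F) c)) = 1 ⊗ₜ (algebraMap F (ExtOmega F) c) := by
      rw [resMap_algebraMap, AlgHom.commutes, Algebra.TensorProduct.algebraMap_apply,
        Algebra.algebraMap_self_apply, Algebra.algebraMap_eq_smul_one (A := K),
        Algebra.algebraMap_eq_smul_one (A := ExtOmega F), TensorProduct.tmul_smul,
        TensorProduct.smul_tmul']
    exact congrArg (· * _) this
  | add x y hx hy => rw [map_add, map_add, add_mul, hx, hy, TensorProduct.tmul_add, add_mul]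
  | mul_ι v x hx =>
    have h1 : baseChangeι K (g v) * baseChangeι K u
        = baseChangeι K (1 ⊗ₜ v) * baseChangeι K u := by
      rw [hg, map_sub, map_smul, sub_mul, smul_mul_assoc, baseChangeι_mul_self, smul_zero, sub_zero]
    have h2 : (1 : K) ⊗ₜ[F] (x * ExteriorAlgebra.ι F v) = (1 ⊗ₜ x) * baseChangeι K (1 ⊗ₜ v) := by
      simp [baseChangeι]
    change Ψ (resMap F K (x * ExteriorAlgebra.ι F v)) * _
      = ((1 : K) ⊗ₜ[F] (x * ExteriorAlgebra.ι F v)) * _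
    rw [map_mul, map_mul, hι, mul_assoc, h1, h2, mul_assoc, baseChangeι_mul_swap, mul_neg, mul_neg,
      ← mul_assoc, hx, mul_assoc]

theorem mul_dform_coeff_of_resMap_eq_zero {a : K} (ha : IsIntegral F a)
    (htop : Algebra.adjoin F {a} = ⊤)
    {ℓ : Module.Dual F Ω[F⁄ℤ]}
    (hℓ : ∑ i ∈ Finset.range (minpoly F a).natDegree,
      a ^ i * algebraMap F K (ℓ (KaehlerDifferential.D ℤ F ((minpoly F a).coeff i))) ≠ 0)
    {ω : ExtOmega F} (hω : resMap F K ω = 0) (i : ℕ) :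
    ω * dform F ((minpoly F a).coeff i) = 0 := by
  obtain ⟨Ψ, hΨ⟩ := exists_algHom_resMap_mul ha htop hℓ
  have h := hΨ ω
  rw [hω, map_zero, zero_mul, minpolyDiff, map_sum, Finset.mul_sum] at h
  simp only [baseChangeι, LinearMap.baseChange_tmul, Algebra.TensorProduct.tmul_mul_tmul,
    one_mul] at h
  rcases lt_trichotomy i (minpoly F a).natDegree with hi | hi | hi
  · rw [Finset.sum_range, eq_comm] at h
    exact (linearIndependent_pow a).eq_zero_of_sum_tmul_eq_zero h ⟨i, hi⟩
  · rw [hi, coeff_natDegree, (minpoly.monic ha).leadingCoeff]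
    simp [dform]
  · simp [coeff_eq_zero_of_natDegree_lt hi, dform]

theorem exists_dual_sum_ne_zero (p : ℕ) [Fact p.Prime] [CharP F p] {a : K} (ha : IsIntegral F a)
    (hsep : ¬ IsSeparable F a) :
    ∃ ℓ : Module.Dual F Ω[F⁄ℤ], ∑ i ∈ Finset.range (minpoly F a).natDegree,
      a ^ i * algebraMap F K (ℓ (KaehlerDifferential.D ℤ F ((minpoly F a).coeff i))) ≠ 0 := by
  obtain ⟨j, hj⟩ := exists_coeff_D_ne_zero p (minpoly.irreducible ha) hsep
  obtain ⟨ℓ, hℓ⟩ := Module.Projective.exists_dual_eq_one F hj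
  refine ⟨ℓ, fun h => ?_⟩
  have hjd : j < (minpoly F a).natDegree := by
    by_contra! hle
    rcases hle.eq_or_lt with hi | hi
    · rw [← hi, coeff_natDegree, (minpoly.monic ha).leadingCoeff] at hj
      simp at hj
    · simp [coeff_eq_zero_of_natDegree_lt hi] at hj
  rw [Finset.sum_range] at h
  have := Fintype.linearIndependent_iff.1 (linearIndependent_pow (K := F) a)
    (fun i => ℓ (KaehlerDifferential.D ℤ F ((minpoly F a).coeff i)))
    (by simpa [Algebra.smul_def, mul_comm] using h) ⟨j, hjd⟩
  rw [hℓ] at this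
  exact one_ne_zero this

theorem resMap_eq_zero_iff (p : ℕ) [Fact p.Prime] [CharP F p] {a : K} (ha : IsIntegral F a)
    (htop : Algebra.adjoin F {a} = ⊤) (hsep : ¬ IsSeparable F a) (ω : ExtOmega F) :
    resMap F K ω = 0 ↔ ∀ i, ω * dform F ((minpoly F a).coeff i) = 0 := by
  have hder : derivative (minpoly F a) = 0 := by
    by_contra h
    exact hsep ((separable_iff_derivative_ne_zero (minpoly.irreducible ha)).2 h)
  obtain ⟨ℓ, hℓ⟩ := exists_dual_sum_ne_zero p ha hsep
  exact ⟨fun h => mul_dform_coeff_of_resMap_eq_zero ha htop hℓ h,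
    resMap_eq_zero_of_mul_dform_coeff ha hder hℓ⟩

theorem omegaKer_eq_annOmega (p : ℕ) [Fact p.Prime] [CharP F p] (n : ℕ) {a : K}
    (ha : IsIntegral F a) (htop : Algebra.adjoin F {a} = ⊤) (hsep : ¬ IsSeparable F a) :
    OmegaKer F K n = (annOmega F n
      (dform F '' {c : F | c ≠ 0 ∧ ∃ i : ℕ, (minpoly F a).coeff i = c}) : Set (ExtOmega F)) := by
  ext ω
  simp only [OmegaKer, annOmega, Set.mem_ofPred_eq, resMap_eq_zero_iff p ha htop hsep,
    SetLike.mem_coe, Submodule.mem_inf, Submodule.mem_iInf, LinearMap.mem_ker,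
    LinearMap.mulRight_apply, Set.forall_mem_image]
  refine and_congr_right fun _ => ⟨?_, fun h i => ?_⟩
  · rintro h _ ⟨-, i, rfl⟩
    exact h i
  · by_cases h0 : (minpoly F a).coeff i = 0
    · simp [h0, dform]
    · exact h ⟨h0, i, rfl⟩

end

end

/-- Proposition 5.1(b). Let `α` be an element of an algebraic closure of
`F` which is (algebraic and) not separable over `F`, let `K = F(α)` and let `C_F(α)` be the
set of nonzero coefficients of the minimal polynomial of `α` over `F`. Then
`Ωⁿ(K/F) = annΩ^n_F(d C_F(α))` and `ν_n(K/F) = ann ν^n_F(d C_F(α))`. -/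
theorem stmt18 (F : Type) [Field F] (p : ℕ) [Fact p.Prime] [CharP F p]
    (n : ℕ) (α : AlgebraicClosure F) (halg : IsAlgebraic F α)
    (hsep : ¬ IsSeparable F α) :
    OmegaKer F (IntermediateField.adjoin F {α}) n =
        ((annOmega F n
            (dform F '' {c : F | c ≠ 0 ∧ ∃ i : ℕ, (minpoly F α).coeff i = c}) :
          Submodule F (ExtOmega F)) : Set (ExtOmega F)) ∧
      nuKer F (IntermediateField.adjoin F {α}) n =
        ((annNu F n
            (dform F '' {c : F | c ≠ 0 ∧ ∃ i : ℕ, (minpoly F α).coeff i = c}) :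
          AddSubgroup (ExtOmega F)) : Set (ExtOmega F)) := by
  have ha : IsIntegral F (IntermediateField.AdjoinSimple.gen F α) :=
    (IntermediateField.AdjoinSimple.isIntegral_gen F α).2 halg.isIntegral
  have htop : Algebra.adjoin F {IntermediateField.AdjoinSimple.gen F α} = ⊤ :=
    (IntermediateField.adjoin.powerBasis halg.isIntegral).adjoin_gen_eq_top
  have hmin := IntermediateField.minpoly_gen F α
  have hsep' : ¬ IsSeparable F (IntermediateField.AdjoinSimple.gen F α) := by
    rwa [IsSeparable, hmin]
  have h := omegaKer_eq_annOmega p n ha htop hsep'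
  rw [hmin] at h
  refine ⟨h, ?_⟩
  rw [nuKer, h]
  rfl
end
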